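/- arXiv:1507.01276 — 9 statements merged into one kernel-verified Lean document; each statement's English description precedes it below -/
import Mathlib

section
/- There is an absolute constant C with the following property. Let n ≥ 2 be a natural number and 0 < ε ≤ 1 a real with n ≥ C/ε⁴. Let G be a group, let A_1,…,A_n ∈ G, and let μ : G → [0,∞) be the probability measure μ(x) := (1/(2n))·(#{i : A_i = x} + #{i : A_i⁻¹ = x}), i.e. the distribution of a random element chosen uniformly among A_1,…,A_n,A_1⁻¹,…,A_n⁻¹ (counted with multiplicity); thus sup_{B∈G} μ^{*n}(B) is the maximal probability that a product A'_1⋯A'_n of n i.i.d. such random elements equals a fixed B. If sup_{B∈G} μ^{*n}(B) > 1/(ε·√n), then there exists a finite subgroup H of G with |H| ≤ C·ε·√n such that A_i ∈ H for at least (1 − C·ε²)·n indices i ∈ {1,…,n}. -/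
universe u

/-- The convolution `μ * ν (x) = ∑_y μ(y) ν(y⁻¹ x)` of two discrete measures on a group. -/
noncomputable def mconv {G : Type u} [Group G] (μ ν : G → ℝ) : G → ℝ :=
  fun x => ∑' y, μ y * ν (y⁻¹ * x)

/-- The `n`-fold convolution power `μ^{*n}` (with `μ^{*0}` the point mass at the identity). -/
noncomputable def mconvPow {G : Type u} [Group G] [DecidableEq G] (μ : G → ℝ) : ℕ → G → ℝ
  | 0 => fun x => if x = 1 then 1 else 0
  | n + 1 => mconv μ (mconvPow μ n)

section LO
variable {G : Type u} [Group G]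

theorem lo_fs_summable {α : Type*} {f : α → ℝ} (hf : f.support.Finite) : Summable f :=
  summable_of_hasFiniteSupport hf

theorem lo_fs_of {α : Type*} {f g : α → ℝ} (hf : f.support.Finite)
    (h : ∀ x, f x = 0 → g x = 0) : g.support.Finite :=
  hf.subset (fun x hx hfx => hx (h x hfx))

theorem lo_fs_inj {α β : Type*} {f : α → ℝ} (hf : f.support.Finite) (e : β → α)
    (he : Function.Injective e) : (fun x => f (e x)).support.Finite :=
  (hf.preimage he.injOn).subset (fun _ hx => hx)

theorem lo_tsum_eq {α : Type*} {f : α → ℝ} (hf : f.support.Finite) (φ : α → ℝ) :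
    ∑' y, f y * φ y = ∑ y ∈ hf.toFinset, f y * φ y := by
  apply tsum_eq_sum
  intro b hb
  have : f b = 0 := by simpa using hb
  simp [this]

theorem lo_fs_conv {μ ν : G → ℝ} (hμ : μ.support.Finite) (hν : ν.support.Finite) :
    (mconv μ ν).support.Finite := by
  refine ((hμ.mul hν)).subset ?_
  intro x hx
  by_contra hcon
  apply hx
  unfold mconv
  rw [lo_tsum_eq hμ]
  apply Finset.sum_eq_zero
  intro y hy
  by_contra h
  apply hcon
  refine Set.mem_mul.2 ⟨y, left_ne_zero_of_mul h, y⁻¹ * x, right_ne_zero_of_mul h, by group⟩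

/-- sum of a convolution against a test function -/
theorem lo_conv_test {μ ν : G → ℝ} (hμ : μ.support.Finite) (hν : ν.support.Finite)
    (φ : G → ℝ) :
    ∑' x, mconv μ ν x * φ x = ∑' y, μ y * ∑' z, ν z * φ (y * z) := by
  rw [lo_tsum_eq hμ]
  have h1 : ∀ x, mconv μ ν x * φ x = ∑ y ∈ hμ.toFinset, μ y * ν (y⁻¹ * x) * φ x := by
    intro x
    unfold mconv
    rw [lo_tsum_eq hμ, Finset.sum_mul]
  simp_rw [h1]
  rw [Summable.tsum_finsetSum]
  · apply Finset.sum_congr rfl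
    intro y _
    rw [← tsum_mul_left, ← (Equiv.mulLeft y).tsum_eq]
    apply tsum_congr
    intro z
    simp
    ring
  · intro y _
    apply lo_fs_summable
    apply lo_fs_of (lo_fs_inj hν (fun x => y⁻¹ * x) (mul_right_injective _))
    intro x hx
    simp [hx]

theorem lo_conv_assoc {μ ν ρ : G → ℝ} (hμ : μ.support.Finite) (hν : ν.support.Finite) :
    mconv (mconv μ ν) ρ = mconv μ (mconv ν ρ) := by
  funext x
  have := lo_conv_test hμ hν (fun w => ρ (w⁻¹ * x))
  unfold mconv at this ⊢
  rw [this]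
  apply tsum_congr
  intro y
  congr 1
  apply tsum_congr
  intro z
  simp [mul_assoc]

variable [DecidableEq G]

theorem lo_fs_pow {μ : G → ℝ} (hμ : μ.support.Finite) (n : ℕ) :
    (mconvPow μ n).support.Finite := by
  induction n with
  | zero =>
    refine (Set.finite_singleton (1 : G)).subset ?_
    intro x hx
    by_contra h
    apply hx
    simp at h
    simp [mconvPow, h]
  | succ n ih => exact lo_fs_conv hμ ih

theorem lo_pow_nonneg {μ : G → ℝ} (h0 : ∀ x, 0 ≤ μ x) (n : ℕ) (x : G) :
    0 ≤ mconvPow μ n x := by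
  induction n generalizing x with
  | zero => simp only [mconvPow]; split_ifs <;> norm_num
  | succ n ih => exact tsum_nonneg (fun y => mul_nonneg (h0 y) (ih _))

theorem lo_pow_mass {μ : G → ℝ} (hμ : μ.support.Finite) (h1 : ∑' x, μ x = 1) (n : ℕ) :
    ∑' x, mconvPow μ n x = 1 := by
  induction n with
  | zero => simp [mconvPow]
  | succ n ih =>
    have := lo_conv_test hμ (lo_fs_pow hμ n) (fun _ => 1)
    simp only [mul_one, ih, h1] at this
    exact this

theorem lo_one_conv (ρ : G → ℝ) : mconv (fun x : G => if x = 1 then (1:ℝ) else 0) ρ = ρ := by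
  funext x
  unfold mconv
  rw [tsum_eq_single 1]
  · simp
  · intro y hy; simp [hy]

theorem lo_conv_one (ρ : G → ℝ) : mconv ρ (fun x : G => if x = 1 then (1:ℝ) else 0) = ρ := by
  funext x
  unfold mconv
  rw [tsum_eq_single x]
  · simp
  · intro y hy
    have : ¬ (y⁻¹ * x = 1) := by
      intro h; exact hy (inv_mul_eq_one.1 h)
    simp [this]

theorem lo_pow_add {μ : G → ℝ} (hμ : μ.support.Finite) (m k : ℕ) :
    mconvPow μ (m + k) = mconv (mconvPow μ m) (mconvPow μ k) := by
  induction m with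
  | zero => simp only [mconvPow, zero_add]; rw [lo_one_conv]
  | succ m ih =>
    rw [show m + 1 + k = (m + k) + 1 by ring]
    simp only [mconvPow]
    rw [ih, lo_conv_assoc hμ (lo_fs_pow hμ m)]

theorem lo_pow_symm {μ : G → ℝ} (hμ : μ.support.Finite) (hs : ∀ x, μ x⁻¹ = μ x) (n : ℕ) (x : G) :
    mconvPow μ n x⁻¹ = mconvPow μ n x := by
  induction n generalizing x with
  | zero => simp [mconvPow]
  | succ n ih =>
    have e1 : mconvPow μ (n+1) x⁻¹ = mconv (mconvPow μ n) μ x⁻¹ := by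
      rw [lo_pow_add hμ n 1]
      congr 1
      simp only [mconvPow]
      exact lo_conv_one μ
    rw [e1]
    simp only [mconvPow, mconv]
    rw [← (Equiv.mulLeft x⁻¹).tsum_eq]
    apply tsum_congr
    intro y
    simp only [Equiv.coe_mulLeft]
    rw [← ih, mul_comm, ← hs y]
    congr 2 <;> group

/-- coset peak decay -/
theorem lo_coset {μ : G → ℝ} (hμ : μ.support.Finite) (h0 : ∀ x, 0 ≤ μ x) (h1 : ∑' x, μ x = 1)
    (φ : G → ℝ) (H : Subgroup G) (hφ : ∀ x, (x ∈ H ∧ φ x = 1) ∨ (x ∉ H ∧ φ x = 0))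
    (δ : ℝ) (hδ : 0 ≤ δ)
    (hq : ∀ x y : G, ∑' s, μ s * φ (x⁻¹ * (s⁻¹ * y)) ≤ 1 - δ) (j : ℕ) (x : G) :
    ∑' z, mconvPow μ j z * φ (x⁻¹ * z) ≤ max (3/4) (1 - j * δ / 2) := by
  have hφ0 : ∀ x, 0 ≤ φ x := fun x => by rcases hφ x with h | h <;> simp [h.2]
  have hφ1 : ∀ x, φ x ≤ 1 := fun x => by rcases hφ x with h | h <;> simp [h.2]
  have hfs : ∀ j (ψ : G → ℝ), (fun z => mconvPow μ j z * ψ z).support.Finite := fun j ψ =>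
    lo_fs_of (lo_fs_pow hμ j) (fun x hx => by simp [hx])
  have hμs : ∀ ψ : G → ℝ, Summable (fun z => μ z * ψ z) := fun ψ =>
    lo_fs_summable (lo_fs_of hμ (fun x hx => by simp [hx]))
  induction j generalizing x with
  | zero =>
    apply le_max_of_le_right
    simp only [Nat.cast_zero, zero_mul, zero_div, sub_zero]
    rw [← lo_pow_mass hμ h1 0]
    apply Summable.tsum_le_tsum _ (lo_fs_summable (hfs 0 _)) (lo_fs_summable (lo_fs_pow hμ 0))
    intro z
    exact mul_le_of_le_one_right (lo_pow_nonneg h0 _ _) (hφ1 _)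
  | succ j ih =>
    have key : ∑' z, mconvPow μ (j+1) z * φ (x⁻¹ * z)
        = ∑' s, μ s * ∑' z, mconvPow μ j z * φ ((s⁻¹ * x)⁻¹ * z) := by
      have := lo_conv_test hμ (lo_fs_pow hμ j) (fun z => φ (x⁻¹ * z))
      simp only [mconvPow]
      rw [this]
      apply tsum_congr; intro s; congr 1; apply tsum_congr; intro z
      congr 2; group
    rw [key]
    by_cases hall : ∀ x, ∑' z, mconvPow μ j z * φ (x⁻¹ * z) ≤ 3/4
    · apply le_max_of_le_left
      calc _ ≤ ∑' s, μ s * (3/4) := by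
            apply Summable.tsum_le_tsum _ (hμs _) (hμs _)
            intro s
            exact mul_le_mul_of_nonneg_left (hall _) (h0 s)
        _ = 3/4 := by rw [tsum_mul_right, h1, one_mul]
    · push Not at hall
      obtain ⟨w, hw⟩ := hall
      set σ := ∑' z, mconvPow μ j z * φ (w⁻¹ * z) with hσ
      have hσ1 : σ ≤ 1 - j * δ / 2 := by
        rcases le_max_iff.1 (ih w) with h | h
        · linarith
        · exact h
      apply le_max_of_le_right
      have pt : ∀ v, ∑' z, mconvPow μ j z * φ (v⁻¹ * z)
          ≤ (1 - σ) + (2 * σ - 1) * φ (w⁻¹ * v) := by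
        intro v
        rcases hφ (w⁻¹ * v) with ⟨h, e⟩ | ⟨h, e⟩
        · have : ∀ z, φ (v⁻¹ * z) = φ (w⁻¹ * z) := by
            intro z
            have hz : v⁻¹ * z ∈ H ↔ w⁻¹ * z ∈ H := by
              rw [show w⁻¹ * z = (w⁻¹ * v) * (v⁻¹ * z) by group]
              exact (H.mul_mem_cancel_left h).symm
            rcases hφ (v⁻¹ * z) with ⟨a, b⟩ | ⟨a, b⟩ <;> rcases hφ (w⁻¹ * z) with ⟨c, d⟩ | ⟨c, d⟩
            · rw [b, d]
            · exact absurd (hz.1 a) c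
            · exact absurd (hz.2 c) a
            · rw [b, d]
          simp_rw [this, e]
          linarith
        · rw [e]
          have : ∑' z, mconvPow μ j z * φ (v⁻¹ * z) + σ ≤ 1 := by
            rw [hσ, ← Summable.tsum_add (lo_fs_summable (hfs j _)) (lo_fs_summable (hfs j _)),
              ← lo_pow_mass hμ h1 j]
            apply Summable.tsum_le_tsum _ _ (lo_fs_summable (lo_fs_pow hμ j))
            · intro z
              rw [← mul_add]
              apply mul_le_of_le_one_right (lo_pow_nonneg h0 _ _)
              rcases hφ (v⁻¹ * z) with ⟨a, b⟩ | ⟨a, b⟩ <;>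
                rcases hφ (w⁻¹ * z) with ⟨c, d⟩ | ⟨c, d⟩
              · exfalso
                apply h
                have := H.mul_mem c (H.inv_mem a)
                rwa [show w⁻¹ * z * (v⁻¹ * z)⁻¹ = w⁻¹ * v by group] at this
              all_goals rw [b, d]; norm_num
            · exact (lo_fs_summable (hfs j _)).add (lo_fs_summable (hfs j _))
          linarith
      calc _ ≤ ∑' s, ((1 - σ) * μ s + (2 * σ - 1) * (μ s * φ (w⁻¹ * (s⁻¹ * x)))) := by
            apply Summable.tsum_le_tsum _ (hμs _)
              (((lo_fs_summable hμ).mul_left _).add ((hμs _).mul_left _))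
            intro s
            have := mul_le_mul_of_nonneg_left (pt (s⁻¹ * x)) (h0 s)
            linarith
        _ = (1 - σ) + (2 * σ - 1) * ∑' s, μ s * φ (w⁻¹ * (s⁻¹ * x)) := by
            rw [Summable.tsum_add ((lo_fs_summable hμ).mul_left _) ((hμs _).mul_left _),
              tsum_mul_left, tsum_mul_left, h1, mul_one]
        _ ≤ (1 - σ) + (2 * σ - 1) * (1 - δ) := by
            have := mul_le_mul_of_nonneg_left (hq w x) (show 0 ≤ 2 * σ - 1 by linarith)
            linarith
        _ ≤ _ := by
            push_cast
            nlinarith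

/-- indicator of a set as a real function -/
noncomputable def loInd (s : Set G) : G → ℝ := s.indicator (fun _ => 1)

theorem loInd_mem {s : Set G} {x : G} (h : x ∈ s) : loInd s x = 1 := by
  simp [loInd, h]

theorem loInd_not {s : Set G} {x : G} (h : x ∉ s) : loInd s x = 0 := by
  simp [loInd, h]

theorem loInd_nonneg (s : Set G) (x : G) : 0 ≤ loInd s x := by
  by_cases h : x ∈ s
  · rw [loInd_mem h]; norm_num
  · rw [loInd_not h]

theorem loInd_le (s : Set G) (x : G) : loInd s x ≤ 1 := by
  by_cases h : x ∈ s
  · rw [loInd_mem h]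
  · rw [loInd_not h]; norm_num

theorem lo_wsum {μ : G → ℝ} (hμ : μ.support.Finite) (ψ : G → ℝ) :
    Summable (fun z => μ z * ψ z) :=
  lo_fs_summable (lo_fs_of hμ (fun x hx => by simp [hx]))

theorem lo_wmono {μ : G → ℝ} (hμ : μ.support.Finite) (h0 : ∀ x, 0 ≤ μ x) {φ ψ : G → ℝ}
    (h : ∀ x, φ x ≤ ψ x) : ∑' x, μ x * φ x ≤ ∑' x, μ x * ψ x :=
  Summable.tsum_le_tsum (fun x => mul_le_mul_of_nonneg_left (h x) (h0 x)) (lo_wsum hμ _)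
    (lo_wsum hμ _)

theorem lo_sub {μ : G → ℝ} (hμ : μ.support.Finite) (h0 : ∀ x, 0 ≤ μ x) (h1 : ∑' x, μ x = 1)
    (hs : ∀ x, μ x⁻¹ = μ x) (K δ : ℝ) (hδ : 0 ≤ 1 - 2 * δ)
    (hH : ∀ H : Subgroup G, (H : Set G).Finite → (Nat.card H : ℝ) ≤ K →
      ∑' s, μ s * loInd (H : Set G) s < 1 - 2 * δ)
    (L : Subgroup G) (hL : (L : Set G).Finite) (hLK : 2 * (Nat.card L : ℝ) ≤ K) (x y : G) :
    ∑' s, μ s * loInd (L : Set G) (x⁻¹ * (s⁻¹ * y)) ≤ 1 - δ := by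
  by_contra hcon
  push Not at hcon
  set φ : G → ℝ := fun s => loInd (L : Set G) (x⁻¹ * (s⁻¹ * y)) with hφ
  set S : Set G := {s | x⁻¹ * (s⁻¹ * y) ∈ L ∧ x⁻¹ * (s * y) ∈ L} with hS
  have hinv : ∑' s, μ s * φ s⁻¹ = ∑' s, μ s * φ s := by
    rw [← (Equiv.inv G).tsum_eq]
    apply tsum_congr
    intro s
    simp [hs]
  have hSm : 1 - 2 * δ < ∑' s, μ s * loInd S s := by
    have e : ∑' s, μ s * (φ s + φ s⁻¹ - 1) = 2 * (∑' s, μ s * φ s) - 1 := by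
      have : ∀ s, μ s * (φ s + φ s⁻¹ - 1) = μ s * φ s + μ s * φ s⁻¹ - μ s := fun s => by ring
      simp_rw [this]
      rw [Summable.tsum_sub ((lo_wsum hμ _).add (lo_wsum hμ _)) (lo_fs_summable hμ),
        Summable.tsum_add (lo_wsum hμ _) (lo_wsum hμ _), hinv, h1]
      ring
    have : ∑' s, μ s * (φ s + φ s⁻¹ - 1) ≤ ∑' s, μ s * loInd S s := by
      apply lo_wmono hμ h0
      intro s
      simp only [hφ, inv_inv]
      by_cases ha : x⁻¹ * (s⁻¹ * y) ∈ L
      · by_cases hb : x⁻¹ * (s * y) ∈ L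
        · rw [loInd_mem (s := S) ⟨ha, hb⟩, loInd_mem (s := (L : Set G)) ha,
            loInd_mem (s := (L : Set G)) hb]
          norm_num
        · rw [loInd_not (s := (L : Set G)) hb]
          linarith [loInd_le (L : Set G) (x⁻¹ * (s⁻¹ * y)), loInd_nonneg S s]
      · rw [loInd_not (s := (L : Set G)) ha]
        linarith [loInd_le (L : Set G) (x⁻¹ * (s * y)), loInd_nonneg S s]
    linarith
  have hne : ∃ s, s ∈ S := by
    by_contra hno
    push Not at hno
    have : ∑' s, μ s * loInd S s = 0 := by
      simp_rw [fun s => loInd_not (hno s)]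
      simp
    linarith
  obtain ⟨s, hsS⟩ := hne
  have Sinv : ∀ a ∈ S, a⁻¹ ∈ S := fun a ha => ⟨by simpa using ha.2, ha.1⟩
  have Sdiv : ∀ a ∈ S, ∀ b ∈ S, x⁻¹ * (a⁻¹ * b) * x ∈ L := by
    intro a ha b hb
    have := L.mul_mem ha.1 (L.inv_mem hb.1)
    rwa [show x⁻¹ * (a⁻¹ * y) * (x⁻¹ * (b⁻¹ * y))⁻¹ = x⁻¹ * (a⁻¹ * b) * x by group] at this
  have Smul : ∀ a ∈ S, ∀ b ∈ S, x⁻¹ * (a * b) * x ∈ L := by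
    intro a ha b hb
    have := Sdiv a⁻¹ (Sinv a ha) b hb
    simpa using this
  have step : ∀ a ∈ S, ∀ h, (x⁻¹ * h * x ∈ L ∨ x⁻¹ * (s * h) * x ∈ L) →
      (x⁻¹ * (a * h) * x ∈ L ∨ x⁻¹ * (s * (a * h)) * x ∈ L) := by
    intro a ha h hh
    rcases hh with hh | hh
    · right
      have := L.mul_mem (Smul s hsS a ha) hh
      rwa [show x⁻¹ * (s * a) * x * (x⁻¹ * h * x) = x⁻¹ * (s * (a * h)) * x by group] at this
    · left
      have := L.mul_mem (Smul a ha s⁻¹ (Sinv s hsS)) hh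
      rwa [show x⁻¹ * (a * s⁻¹) * x * (x⁻¹ * (s * h) * x) = x⁻¹ * (a * h) * x by group] at this
  have hcl : ∀ h ∈ Subgroup.closure S, x⁻¹ * h * x ∈ L ∨ x⁻¹ * (s * h) * x ∈ L := by
    intro h hh
    induction hh using Subgroup.closure_induction_left with
    | one => left; simp
    | mul_left a ha h _ ih => exact step a ha h ih
    | inv_mul_cancel a ha h _ ih => exact step a⁻¹ (Sinv a ha) h ih
  have hsub : (Subgroup.closure S : Set G) ⊆
      (fun l => x * l * x⁻¹) '' (L : Set G) ∪ (fun l => s⁻¹ * (x * l * x⁻¹)) '' (L : Set G) := by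
    intro h hh
    rcases hcl h hh with h' | h'
    · left; exact ⟨_, h', by group⟩
    · right; exact ⟨_, h', by group⟩
  have hfin := (hL.image (fun l => x * l * x⁻¹)).union (hL.image (fun l => s⁻¹ * (x * l * x⁻¹)))
  have hcard : (Subgroup.closure S : Set G).ncard ≤ (L : Set G).ncard + (L : Set G).ncard :=
    (Set.ncard_le_ncard hsub hfin).trans ((Set.ncard_union_le _ _).trans
      (add_le_add (Set.ncard_image_le hL) (Set.ncard_image_le hL)))
  have hc2 : (Nat.card (Subgroup.closure S) : ℝ) ≤ K := by
    have : Nat.card (Subgroup.closure S) ≤ Nat.card L + Nat.card L := hcard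
    have : (Nat.card (Subgroup.closure S) : ℝ) ≤ Nat.card L + Nat.card L := by exact_mod_cast this
    linarith
  have h3 := hH _ (hfin.subset hsub) hc2
  have h4 : ∑' s, μ s * loInd S s ≤
      ∑' s, μ s * loInd (Subgroup.closure S : Set G) s := by
    apply lo_wmono hμ h0
    intro a
    by_cases ha : a ∈ S
    · rw [loInd_mem ha, loInd_mem (Subgroup.subset_closure ha)]
    · rw [loInd_not ha]; exact loInd_nonneg _ _
  linarith

theorem lo_fs_diff {g : G → ℝ} (hg : g.support.Finite) (y : G) (θ : ℝ → ℝ) (hθ : θ 0 = 0) :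
    (fun x => θ (g x - g (x * y))).support.Finite := by
  refine (hg.union (lo_fs_inj hg (fun x => x * y) (mul_left_injective _))).subset ?_
  intro x hx
  by_contra h
  simp only [Set.mem_union, Function.mem_support, not_or, not_not] at h
  apply hx
  simp [h.1, h.2, hθ]

theorem lo_level {ν : G → ℝ} (hν : ν.support.Finite) (h0 : ∀ x, 0 ≤ ν x) (c : ℝ) (N : ℕ)
    (g : G → ℝ) (hg : g.support.Finite) (hg0 : ∀ x, 0 ≤ g x) (hN : hg.toFinset.card ≤ N)
    (hF : ∀ F : Finset G, F.Nonempty → F.card ≤ N →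
      c ≤ ∑' y, ν y * ∑' x, |loInd (F : Set G) x - loInd (F : Set G) (x * y)|) (hc : 0 ≤ c) (x₀ : G) :
    c * g x₀ ≤ ∑' y, ν y * ∑' x, |g x - g (x * y)| := by
  induction N generalizing g with
  | zero =>
    have : hg.toFinset = ∅ := by simpa using hN
    have : x₀ ∉ hg.toFinset := by simp [this]
    have : g x₀ = 0 := by simpa using this
    rw [this, mul_zero]
    exact tsum_nonneg fun y => mul_nonneg (h0 y) (tsum_nonneg fun x => abs_nonneg _)
  | succ N ih =>
    by_cases hne : hg.toFinset.Nonempty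
    swap
    · have : x₀ ∉ hg.toFinset := fun h => hne ⟨_, h⟩
      have : g x₀ = 0 := by simpa using this
      rw [this, mul_zero]
      exact tsum_nonneg fun y => mul_nonneg (h0 y) (tsum_nonneg fun x => abs_nonneg _)
    obtain ⟨x₁, hx₁, hmin⟩ := Finset.exists_min_image hg.toFinset g hne
    set F := hg.toFinset with hFdef
    have hmem : ∀ x, x ∈ F ↔ g x ≠ 0 := by intro x; simp [hFdef]
    set m := g x₁ with hm
    have hm0 : 0 ≤ m := hg0 _
    set g' : G → ℝ := fun x => g x - m * loInd (F : Set G) x with hg'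
    have hin : ∀ x, x ∈ F → loInd (F : Set G) x = 1 := fun x h => loInd_mem (by exact_mod_cast h)
    have hout : ∀ x, x ∉ F → loInd (F : Set G) x = 0 := fun x h => loInd_not (by exact_mod_cast h)
    have hgo : ∀ x, x ∉ F → g x = 0 := fun x h => by
      by_contra h'; exact h ((hmem x).2 h')
    have hg'o : ∀ x, x ∉ F → g' x = 0 := fun x h => by simp [hg', hout x h, hgo x h]
    have hg's : g'.support ⊆ ((F.erase x₁ : Finset G) : Set G) := by
      intro x hx
      have h1 : x ∈ F := by by_contra h; exact hx (hg'o x h)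
      have h2 : x ≠ x₁ := by
        rintro rfl; apply hx; simp [hg', hin _ hx₁, hm]
      simp [h1, h2]
    have hg'f : g'.support.Finite := (Finset.finite_toSet _).subset hg's
    have hg'0 : ∀ x, 0 ≤ g' x := by
      intro x
      by_cases h : x ∈ F
      · simp only [hg', hin x h]; linarith [hmin x h]
      · rw [hg'o x h]
    have hcard : hg'f.toFinset.card ≤ N := by
      have h1 : hg'f.toFinset ⊆ F.erase x₁ := by
        intro x hx
        have := hg's (by simpa using hx : x ∈ g'.support)
        exact_mod_cast this
      have h2 := Finset.card_le_card h1
      rw [Finset.card_erase_of_mem hx₁] at h2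
      omega
    have IH := ih g' hg'f hg'0 hcard (fun F h1 h2 => hF F h1 (by omega))
    have hFF := hF F hne hN
    have hIf : (loInd (F : Set G)).support.Finite := by
      refine F.finite_toSet.subset ?_
      intro x hx; by_contra h; exact hx (hout x (by simpa using h))
    have split : ∀ x y, |g x - g (x * y)| =
        m * |loInd (F : Set G) x - loInd (F : Set G) (x * y)| + |g' x - g' (x * y)| := by
      intro x y
      by_cases h1 : x ∈ F <;> by_cases h2 : x * y ∈ F
      · simp [hg', hin _ h1, hin _ h2]
      · have := hg'0 x
        rw [hg'o _ h2, hgo _ h2, hin _ h1, hout _ h2, sub_zero, sub_zero, sub_zero, abs_one,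
          abs_of_nonneg this, abs_of_nonneg (hg0 x)]
        simp [hg', hin _ h1]
      · have := hg'0 (x * y)
        rw [hg'o _ h1, hgo _ h1, hin _ h2, hout _ h1, zero_sub, zero_sub, zero_sub, abs_neg,
          abs_neg, abs_neg, abs_one,
          abs_of_nonneg this, abs_of_nonneg (hg0 _)]
        simp [hg', hin _ h2]
      · simp [hg'o _ h1, hgo _ h1, hout _ h1, hg'o _ h2, hgo _ h2, hout _ h2]
    have tot : ∑' y, ν y * ∑' x, |g x - g (x * y)| =
        m * (∑' y, ν y * ∑' x, |loInd (F : Set G) x - loInd (F : Set G) (x * y)|) +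
        ∑' y, ν y * ∑' x, |g' x - g' (x * y)| := by
      rw [← tsum_mul_left, ← Summable.tsum_add ((lo_wsum hν _).mul_left _) (lo_wsum hν _)]
      apply tsum_congr
      intro y
      simp_rw [fun x => split x y]
      rw [Summable.tsum_add ((lo_fs_summable (lo_fs_diff hIf y abs abs_zero)).mul_left _)
        (lo_fs_summable (lo_fs_diff hg'f y abs abs_zero)), tsum_mul_left]
      ring
    rw [tot]
    have e : g x₀ = m * loInd (F : Set G) x₀ + g' x₀ := by simp [hg']
    have h5 : m * c ≤ m * (∑' y, ν y * ∑' x, |loInd (F : Set G) x - loInd (F : Set G) (x * y)|) :=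
      mul_le_mul_of_nonneg_left hFF hm0
    have h6 : m * c * loInd (F : Set G) x₀ ≤ m * c :=
      mul_le_of_le_one_right (mul_nonneg hm0 hc) (loInd_le _ _)
    rw [e]
    linarith

theorem lo_stab {ν : G → ℝ} (hν : ν.support.Finite) (h0 : ∀ x, 0 ≤ ν x) (h1 : ∑' x, ν x = 1)
    (F : Finset G) (hne : F.Nonempty)
    (hH : ∀ H : Subgroup G, (H : Set G).Finite → Nat.card H ≤ F.card →
      ∑' s, ν s * loInd (H : Set G) s ≤ 3/4) :
    1/4 ≤ ∑' y, ν y * ∑' x, |loInd (F : Set G) x - loInd (F : Set G) (x * y)| := by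
  let H : Subgroup G :=
    { carrier := {y | ∀ x, x ∈ F ↔ x * y ∈ F}
      one_mem' := by intro x; simp
      mul_mem' := by
        intro a b ha hb x
        rw [← mul_assoc, ← hb, ← ha]
      inv_mem' := by
        intro a ha x
        rw [ha (x * a⁻¹)]; simp }
  obtain ⟨x₀, hx₀⟩ := hne
  have hsub : (H : Set G) ⊆ ((F.image (fun z => x₀⁻¹ * z) : Finset G) : Set G) := by
    intro y hy
    have := (hy x₀).1 hx₀
    simp only [Finset.coe_image, Set.mem_image]
    exact ⟨_, by exact_mod_cast this, by group⟩
  have hfin : (H : Set G).Finite := (Finset.finite_toSet _).subset hsub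
  have hcard : Nat.card H ≤ F.card := by
    have h2 := Set.ncard_le_ncard hsub (Finset.finite_toSet _)
    rw [Set.ncard_coe_finset] at h2
    exact (h2 : Nat.card H ≤ _).trans Finset.card_image_le
  have h3 := hH H hfin hcard
  have h4 : ∑' y, ν y * (1 - loInd (H : Set G) y) ≤
      ∑' y, ν y * ∑' x, |loInd (F : Set G) x - loInd (F : Set G) (x * y)| := by
    apply lo_wmono hν h0
    intro y
    by_cases hy : y ∈ (H : Set G)
    · rw [loInd_mem hy, sub_self]; exact tsum_nonneg fun x => abs_nonneg _
    · rw [loInd_not hy, sub_zero]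
      have : ∃ x, ¬ (x ∈ F ↔ x * y ∈ F) := by
        by_contra hno; push Not at hno; exact hy hno
      obtain ⟨x, hx⟩ := this
      have hIf : (loInd (F : Set G)).support.Finite := by
        refine F.finite_toSet.subset ?_
        intro x hx; by_contra h; exact hx (loInd_not h)
      have hsum := lo_fs_summable (lo_fs_diff hIf y abs abs_zero)
      refine le_trans ?_ (hsum.le_tsum x (fun _ _ => abs_nonneg _))
      by_cases a : x ∈ (F : Set G) <;> by_cases b : x * y ∈ (F : Set G)
      · exact absurd (by simp_all) hx
      · rw [loInd_mem a, loInd_not b]; norm_num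
      · rw [loInd_not a, loInd_mem b]; norm_num
      · exact absurd (by simp_all) hx
  have h5 : ∑' y, ν y * (1 - loInd (H : Set G) y) = 1 - ∑' s, ν s * loInd (H : Set G) s := by
    simp_rw [mul_sub, mul_one]
    rw [Summable.tsum_sub (lo_fs_summable hν) (lo_wsum hν _), h1]
  linarith

theorem lo_sq {μ : G → ℝ} (hμ : μ.support.Finite) (hs : ∀ x, μ x⁻¹ = μ x) (m : ℕ) :
    mconvPow μ (m + m) 1 = ∑' x, mconvPow μ m x ^ 2 := by
  rw [lo_pow_add hμ]
  unfold mconv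
  apply tsum_congr
  intro y
  rw [mul_one, lo_pow_symm hμ hs, sq]

theorem lo_cross {μ : G → ℝ} (hμ : μ.support.Finite) (hs : ∀ x, μ x⁻¹ = μ x) (m j : ℕ) :
    mconvPow μ (m + (j + m)) 1 =
      ∑' y, mconvPow μ j y * ∑' x, mconvPow μ m x * mconvPow μ m (x * y) := by
  have e : mconvPow μ (m + (j + m)) 1 =
      ∑' x, mconvPow μ m x * ∑' y, mconvPow μ j y * mconvPow μ m (x * y) := by
    rw [lo_pow_add hμ, lo_pow_add hμ j m]
    unfold mconv
    apply tsum_congr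
    intro x
    congr 1
    apply tsum_congr
    intro y
    congr 1
    rw [← lo_pow_symm hμ hs]
    congr 1
    group
  rw [e, lo_tsum_eq (lo_fs_pow hμ m), lo_tsum_eq (lo_fs_pow hμ j)]
  simp_rw [lo_tsum_eq (lo_fs_pow hμ m), lo_tsum_eq (lo_fs_pow hμ j), Finset.mul_sum]
  rw [Finset.sum_comm]
  apply Finset.sum_congr rfl
  intro y _
  apply Finset.sum_congr rfl
  intro x _
  ring

theorem lo_energy {μ : G → ℝ} (hμ : μ.support.Finite) (h1 : ∑' x, μ x = 1)
    (hs : ∀ x, μ x⁻¹ = μ x) (m j : ℕ) :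
    ∑' y, mconvPow μ j y * ∑' x, (mconvPow μ m x - mconvPow μ m (x * y)) ^ 2
      = 2 * (mconvPow μ (m + m) 1 - mconvPow μ (m + (j + m)) 1) := by
  have hf := lo_fs_pow hμ m
  have inner : ∀ y, ∑' x, (mconvPow μ m x - mconvPow μ m (x * y)) ^ 2 =
      2 * mconvPow μ (m + m) 1 - 2 * ∑' x, mconvPow μ m x * mconvPow μ m (x * y) := by
    intro y
    have s1 : Summable (fun x => mconvPow μ m x ^ 2) :=
      lo_fs_summable (lo_fs_of hf (fun x hx => by simp [hx]))
    have s2 : Summable (fun x => mconvPow μ m (x * y) ^ 2) :=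
      s1.comp_injective (i := fun x => x * y) (mul_left_injective y)
    have e2 : ∑' x, mconvPow μ m (x * y) ^ 2 = ∑' x, mconvPow μ m x ^ 2 :=
      (Equiv.mulRight y).tsum_eq (fun x => mconvPow μ m x ^ 2)
    have s3 := lo_wsum hf (fun x => mconvPow μ m (x * y))
    have : ∀ x, (mconvPow μ m x - mconvPow μ m (x * y)) ^ 2 =
        mconvPow μ m x ^ 2 + mconvPow μ m (x * y) ^ 2
          - 2 * (mconvPow μ m x * mconvPow μ m (x * y)) := fun x => by ring
    simp_rw [this]
    rw [Summable.tsum_sub (s1.add s2) (s3.mul_left 2), Summable.tsum_add s1 s2, e2, tsum_mul_left,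
      lo_sq hμ hs]
    ring
  simp_rw [inner, mul_sub]
  rw [Summable.tsum_sub (lo_wsum (lo_fs_pow hμ j) _) (lo_wsum (lo_fs_pow hμ j) _),
    tsum_mul_right, lo_pow_mass hμ h1, lo_cross hμ hs, ← tsum_mul_left]
  rw [one_mul]
  congr 1
  apply tsum_congr
  intro y
  ring

theorem lo_sup {μ : G → ℝ} (hμ : μ.support.Finite) (h0 : ∀ x, 0 ≤ μ x) (h1 : ∑' x, μ x = 1)
    (hs : ∀ x, μ x⁻¹ = μ x) (m j : ℕ) (B : G) :
    mconvPow μ (j + (m + m)) B ≤ mconvPow μ (m + m) 1 := by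
  have hf := lo_fs_pow hμ m
  have A : ∀ x, mconvPow μ (m + m) x ≤ mconvPow μ (m + m) 1 := by
    intro x
    have s1 : Summable (fun x => mconvPow μ m x ^ 2) :=
      lo_fs_summable (lo_fs_of hf (fun x hx => by simp [hx]))
    have s2 : Summable (fun y => mconvPow μ m (x⁻¹ * y) ^ 2) :=
      s1.comp_injective (i := fun y => x⁻¹ * y) (mul_right_injective _)
    have e2 : ∑' y, mconvPow μ m (x⁻¹ * y) ^ 2 = ∑' x, mconvPow μ m x ^ 2 :=
      (Equiv.mulLeft x⁻¹).tsum_eq (fun x => mconvPow μ m x ^ 2)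
    have e3 : mconvPow μ (m + m) x = ∑' y, mconvPow μ m y * mconvPow μ m (x⁻¹ * y) := by
      rw [lo_pow_add hμ]
      unfold mconv
      apply tsum_congr
      intro y
      rw [← lo_pow_symm hμ hs m (x⁻¹ * y)]
      congr 2
      group
    have : mconvPow μ (m + m) x ≤
        ∑' y, (mconvPow μ m y ^ 2 + mconvPow μ m (x⁻¹ * y) ^ 2) * (1/2) := by
      rw [e3]
      apply Summable.tsum_le_tsum _ (lo_wsum hf _) ((s1.add s2).mul_right _)
      intro y
      nlinarith [sq_nonneg (mconvPow μ m y - mconvPow μ m (x⁻¹ * y))]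
    rw [tsum_mul_right, Summable.tsum_add s1 s2, e2, ← lo_sq hμ hs] at this
    linarith
  rw [lo_pow_add hμ]
  unfold mconv
  calc _ ≤ ∑' y, mconvPow μ j y * mconvPow μ (m + m) 1 :=
        lo_wmono (lo_fs_pow hμ j) (lo_pow_nonneg h0 j) (fun y => A _)
    _ = _ := by rw [tsum_mul_right, lo_pow_mass hμ h1, one_mul]

theorem lo_nash {μ : G → ℝ} (hμ : μ.support.Finite) (h0 : ∀ x, 0 ≤ μ x) (h1 : ∑' x, μ x = 1)
    (hs : ∀ x, μ x⁻¹ = μ x) (m j : ℕ) (p : ℝ) (hp : p = mconvPow μ (m + m) 1) (hp0 : 0 < p)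
    (hH : ∀ H : Subgroup G, (H : Set G).Finite → (Nat.card H : ℝ) ≤ 4 / p →
      ∑' s, mconvPow μ j s * loInd (H : Set G) s ≤ 3/4) :
    mconvPow μ (m + (j + m)) 1 ≤ p - 9 / 4096 * p ^ 3 := by
  set f := mconvPow μ m with hfdef
  set ν := mconvPow μ j with hνdef
  have hf : f.support.Finite := lo_fs_pow hμ m
  have hf0 : ∀ x, 0 ≤ f x := lo_pow_nonneg h0 m
  have hf1 : ∑' x, f x = 1 := lo_pow_mass hμ h1 m
  have hν : ν.support.Finite := lo_fs_pow hμ j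
  have hν0 : ∀ x, 0 ≤ ν x := lo_pow_nonneg h0 j
  have hν1 : ∑' x, ν x = 1 := lo_pow_mass hμ h1 j
  have hsq : p = ∑' x, f x ^ 2 := by rw [hp, lo_sq hμ hs]
  -- the peak
  have hpk : ∃ x₀, p ≤ f x₀ := by
    by_contra hno
    push Not at hno
    have hne : hf.toFinset.Nonempty := by
      by_contra hemp
      rw [Finset.not_nonempty_iff_eq_empty] at hemp
      have : ∀ x, f x = 0 := by
        intro x
        have : x ∉ hf.toFinset := by simp [hemp]
        simpa using this
      simp [this] at hf1
    obtain ⟨x₁, _, hmax⟩ := Finset.exists_max_image hf.toFinset f hne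
    have hle : ∀ x, f x ≤ f x₁ := by
      intro x
      by_cases h : x ∈ hf.toFinset
      · exact hmax x h
      · have : f x = 0 := by simpa using h
        rw [this]; exact hf0 _
    have : ∑' x, f x * f x ≤ ∑' x, f x * f x₁ := lo_wmono hf hf0 hle
    rw [tsum_mul_right, hf1, one_mul] at this
    have e : ∑' x, f x ^ 2 = ∑' x, f x * f x := tsum_congr fun x => sq _
    rw [← e, ← hsq] at this
    linarith [hno x₁]
  obtain ⟨x₀, hx₀⟩ := hpk
  set g : G → ℝ := fun x => max (f x - p / 4) 0 with hgdef
  have hg : g.support.Finite := lo_fs_of hf (fun x hx => by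
    simp only [hgdef, hx]; apply max_eq_right; linarith)
  have hg0 : ∀ x, 0 ≤ g x := fun x => le_max_right _ _
  set F := hg.toFinset with hFdef
  have hFmem : ∀ x, x ∉ F → g x = 0 := by intro x hx; simpa [hFdef] using hx
  have hFlarge : ∀ x ∈ F, p / 4 ≤ f x := by
    intro x hx
    by_contra hlt
    push Not at hlt
    have : g x ≠ 0 := by simpa [hFdef] using hx
    apply this
    simp only [hgdef]; apply max_eq_right; linarith
  have hFcard : (F.card : ℝ) * p ≤ 4 := by
    have h2 : ∑ x ∈ F, f x ≤ 1 := by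
      rw [← hf1]
      exact (lo_fs_summable hf).sum_le_tsum F (fun x _ => hf0 x)
    have h3 := Finset.card_nsmul_le_sum F f (p/4) hFlarge
    rw [nsmul_eq_mul] at h3
    linarith
  have hW : 1/4 * g x₀ ≤ ∑' y, ν y * ∑' x, |g x - g (x * y)| := by
    apply lo_level hν hν0 (1/4) F.card g hg hg0 le_rfl _ (by norm_num)
    intro F' hne hc
    apply lo_stab hν hν0 hν1 F' hne
    intro H hHf hHc
    apply hH H hHf
    rw [le_div_iff₀ hp0]
    have : (Nat.card H : ℝ) ≤ F.card := by exact_mod_cast hHc.trans hc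
    nlinarith
  have hgx : 3 / 4 * p ≤ g x₀ := le_trans (by linarith) (le_max_left _ _)
  have hWl : 3 / 16 * p ≤ ∑' y, ν y * ∑' x, |g x - g (x * y)| := by linarith
  -- pointwise Cauchy-Schwarz
  have hCS : ∀ y, (∑' x, |g x - g (x * y)|) ^ 2 * p ≤ 8 * ∑' x, (f x - f (x * y)) ^ 2 := by
    intro y
    set T := F ∪ F.image (fun z => z * y⁻¹) with hT
    have hTc : (T.card : ℝ) * p ≤ 8 := by
      have : T.card ≤ F.card + F.card :=
        (Finset.card_union_le _ _).trans (add_le_add le_rfl Finset.card_image_le)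
      have : (T.card : ℝ) ≤ F.card + F.card := by exact_mod_cast this
      nlinarith
    have hTo : ∀ x, x ∉ T → g x = 0 ∧ g (x * y) = 0 := by
      intro x hx
      rw [hT, Finset.mem_union, not_or] at hx
      refine ⟨hFmem _ hx.1, hFmem _ fun h => hx.2 ?_⟩
      exact Finset.mem_image.2 ⟨_, h, by group⟩
    have e1 : ∑' x, |g x - g (x * y)| = ∑ x ∈ T, |g x - g (x * y)| := by
      apply tsum_eq_sum
      intro x hx
      simp [hTo x hx]
    have e2 : (∑ x ∈ T, |g x - g (x * y)|) ^ 2 ≤ T.card * ∑ x ∈ T, |g x - g (x * y)| ^ 2 :=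
      sq_sum_le_card_mul_sum_sq
    have e3 : ∑ x ∈ T, |g x - g (x * y)| ^ 2 ≤ ∑ x ∈ T, (f x - f (x * y)) ^ 2 := by
      apply Finset.sum_le_sum
      intro x _
      rw [← sq_abs (f x - f (x * y))]
      apply pow_le_pow_left₀ (abs_nonneg _)
      have := abs_max_sub_max_le_abs (f x - p / 4) (f (x * y) - p / 4) 0
      simpa [hgdef] using this
    have e4 : ∑ x ∈ T, (f x - f (x * y)) ^ 2 ≤ ∑' x, (f x - f (x * y)) ^ 2 :=
      (lo_fs_summable (lo_fs_diff hf y (fun z => z ^ 2) (by norm_num))).sum_le_tsum T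
        (fun x _ => sq_nonneg _)
    rw [e1]
    set E := ∑' x, (f x - f (x * y)) ^ 2
    have e5 : 0 ≤ ∑ x ∈ T, |g x - g (x * y)| ^ 2 := Finset.sum_nonneg fun _ _ => sq_nonneg _
    calc _ ≤ (T.card * ∑ x ∈ T, |g x - g (x * y)| ^ 2) * p := by gcongr
      _ = (T.card * p) * ∑ x ∈ T, |g x - g (x * y)| ^ 2 := by ring
      _ ≤ 8 * ∑ x ∈ T, |g x - g (x * y)| ^ 2 := by gcongr
      _ ≤ 8 * E := by linarith
  have hE := lo_energy hμ h1 hs m j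
  rw [← hfdef, ← hνdef, ← hp] at hE
  set lam := 3 / 16 * p with hlam
  have hfin : ∑' y, ν y * (p * (2 * lam * (∑' x, |g x - g (x * y)|) - lam ^ 2)) ≤
      ∑' y, ν y * (8 * ∑' x, (f x - f (x * y)) ^ 2) := by
    apply lo_wmono hν hν0
    intro y
    refine le_trans ?_ (hCS y)
    nlinarith [mul_nonneg hp0.le (sq_nonneg ((∑' x, |g x - g (x * y)|) - lam))]
  have l1 : ∑' y, ν y * (p * (2 * lam * (∑' x, |g x - g (x * y)|) - lam ^ 2)) =
      p * (2 * lam * (∑' y, ν y * ∑' x, |g x - g (x * y)|) - lam ^ 2) := by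
    have : ∀ y, ν y * (p * (2 * lam * (∑' x, |g x - g (x * y)|) - lam ^ 2)) =
      (p * 2 * lam) * (ν y * ∑' x, |g x - g (x * y)|) - ν y * (p * lam ^ 2) := fun y => by ring
    simp_rw [this]
    rw [Summable.tsum_sub ((lo_wsum hν _).mul_left _) (lo_wsum hν _), tsum_mul_left,
      tsum_mul_right, hν1]
    ring
  have l2 : ∑' y, ν y * (8 * ∑' x, (f x - f (x * y)) ^ 2) =
      8 * ∑' y, ν y * ∑' x, (f x - f (x * y)) ^ 2 := by
    rw [← tsum_mul_left]
    apply tsum_congr; intro y; ring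
  rw [l1, l2, hE] at hfin
  have hl0 : 0 ≤ p * lam := by positivity
  have : p * lam * lam ≤ p * lam * ∑' y, ν y * ∑' x, |g x - g (x * y)| :=
    mul_le_mul_of_nonneg_left hWl hl0
  have e9 : p * lam * lam = 9 / 256 * p ^ 3 := by rw [hlam]; ring
  nlinarith

theorem lo_num (b b' T c : ℝ) (hc : 0 ≤ c) (hc1 : c ≤ 1) (hT : 1 ≤ T) (hb : 0 ≤ b)
    (hb' : 0 ≤ b') (h : b' ≤ b - c * b ^ 3) (hTb : T * b ^ 2 ≤ 1) :
    (T + 2 * c) * b' ^ 2 ≤ 1 := by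
  have hb2 : b ^ 2 ≤ 1 := by nlinarith [sq_nonneg b]
  set z := c * b ^ 2 with hz
  have hz0 : 0 ≤ z := by positivity
  have hz1 : z ≤ 1 := by nlinarith [sq_nonneg b]
  have h2 : b' ≤ b * (1 - z) := by rw [hz]; linarith
  have h3 : b' ^ 2 ≤ (b * (1 - z)) ^ 2 := pow_le_pow_left₀ hb' h2 2
  calc (T + 2 * c) * b' ^ 2 ≤ (T + 2 * c) * (b * (1 - z)) ^ 2 := by gcongr
    _ = (T * b ^ 2 + 2 * z) * (1 - z) ^ 2 := by rw [hz]; ring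
    _ ≤ (1 + 2 * z) * (1 - z) ^ 2 := by gcongr
    _ ≤ 1 := by nlinarith [mul_nonneg (mul_nonneg hz0 hz0) (sub_nonneg.2 hz1), mul_nonneg hz0 hz0]

theorem lo_core {μ : G → ℝ} (hμ : μ.support.Finite) (h0 : ∀ x, 0 ≤ μ x) (h1 : ∑' x, μ x = 1)
    (hs : ∀ x, μ x⁻¹ = μ x) (n : ℕ) (hn : 0 < n) (ε : ℝ) (hε : 0 < ε) (hε1 : 2000 * ε ^ 2 < 1)
    (hH : ∀ H : Subgroup G, (H : Set G).Finite → (Nat.card H : ℝ) ≤ 2000 * ε * Real.sqrt n →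
      ∑' s, μ s * loInd (H : Set G) s < 1 - 2000 * ε ^ 2)
    (B : G) (hB : 1 / (ε * Real.sqrt n) < mconvPow μ n B) : False := by
  have hnR : (0:ℝ) < n := by exact_mod_cast hn
  have hsn : 0 < Real.sqrt n := Real.sqrt_pos.2 hnR
  have hss : Real.sqrt n ^ 2 = n := Real.sq_sqrt hnR.le
  set q := 1 / (ε * Real.sqrt n) with hq
  have hq0 : 0 < q := by positivity
  set δ := 1000 * ε ^ 2 with hδ
  have hδ0 : 0 < δ := by positivity
  set t := ⌈1 / (4 * δ)⌉₊ with ht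
  have ht1 : 1 / (4 * δ) ≤ t := Nat.le_ceil _
  have ht2 : (t : ℝ) < 1 / (4 * δ) + 1 := Nat.ceil_lt_add_one (by positivity)
  have htδ : 1 / 4 ≤ t * δ := by
    rw [div_le_iff₀ (by positivity)] at ht1; linarith
  have htδ2 : (t : ℝ) * δ < 3 / 4 := by
    have : (t : ℝ) * δ < (1 / (4 * δ) + 1) * δ := by gcongr
    have e : (1 / (4 * δ) + 1) * δ = 1 / 4 + δ := by field_simp
    linarith
  have ht0 : 0 < t := by
    rcases Nat.eq_zero_or_pos t with h | h
    · rw [h] at htδ; norm_num at htδ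
    · exact h
  have hsmall : ∀ H : Subgroup G, (H : Set G).Finite →
      2 * (Nat.card H : ℝ) ≤ 2000 * ε * Real.sqrt n →
      ∑' s, mconvPow μ (2 * t) s * loInd (H : Set G) s ≤ 3 / 4 := by
    intro H hHf hHc
    have := lo_coset hμ h0 h1 (loInd (H : Set G)) H (fun x => by
      by_cases hx : x ∈ (H : Set G)
      · left; exact ⟨hx, loInd_mem hx⟩
      · right; exact ⟨hx, loInd_not hx⟩) δ hδ0.le
      (lo_sub hμ h0 h1 hs (2000 * ε * Real.sqrt n) δ (by linarith)
        (fun H a b => (hH H a b).trans_eq (by rw [hδ]; ring)) H hHf hHc) (2 * t) 1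
    simp only [inv_one, one_mul] at this
    refine this.trans (max_le le_rfl ?_)
    push_cast
    linarith
  have hbig : ∀ i, 2 * t * i ≤ n → q < mconvPow μ (t * i + t * i) 1 := by
    intro i hi
    refine lt_of_lt_of_le hB ?_
    have := lo_sup hμ h0 h1 hs (t * i) (n - (t * i + t * i)) B
    rwa [Nat.sub_add_cancel (by linarith)] at this
  have iter : ∀ i, 2 * t * i ≤ n →
      (1 + 2 * (9 / 4096) * i) * (mconvPow μ (t * i + t * i) 1) ^ 2 ≤ 1 := by
    intro i
    induction i with
    | zero => intro _; simp [mconvPow]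
    | succ i ih =>
      intro hi
      have hi' : 2 * t * i ≤ n := by nlinarith
      have h2 := ih hi'
      have hb := hbig i hi'
      have hstep := lo_nash hμ h0 h1 hs (t * i) (2 * t) _ rfl (hq0.trans hb) (by
        intro H hHf hHc
        apply hsmall H hHf
        have : 4 / mconvPow μ (t * i + t * i) 1 ≤ 4 / q := by gcongr
        have e : 4 / q = 4 * (ε * Real.sqrt n) := by rw [hq]; field_simp
        have : 0 < ε * Real.sqrt n := by positivity
        linarith)
      rw [show t * i + (2 * t + t * i) = t * (i + 1) + t * (i + 1) by ring] at hstep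
      have := lo_num _ _ (1 + 2 * (9 / 4096) * i) (9/4096) (by norm_num) (by norm_num)
        (by have : (0:ℝ) ≤ i := Nat.cast_nonneg i
            linarith) (hq0.trans hb).le (hq0.trans (hbig (i+1) hi)).le hstep h2
      push_cast
      linarith
  set N := n / (2 * t) with hN
  have hN1 : 2 * t * N ≤ n := Nat.mul_div_le n (2 * t)
  have hN2 : n < 2 * t * (N + 1) := by
    have := Nat.lt_mul_div_succ n (show 0 < 2 * t by omega)
    simpa [hN] using this
  have hN2R : (n : ℝ) < 2 * t * (N + 1) := by exact_mod_cast hN2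
  have hf := iter N hN1
  have hb := hbig N hN1
  have hqq : q ^ 2 * (ε ^ 2 * n) = 1 := by
    rw [← hss, hq]; field_simp
  have h3 : (1 + 2 * (9 / 4096) * N) * q ^ 2 ≤ 1 := by
    refine le_trans ?_ hf
    gcongr
  have h4 : 1 + 2 * (9 / 4096) * (N : ℝ) ≤ ε ^ 2 * n := by
    have : 0 < ε ^ 2 * n := by positivity
    calc 1 + 2 * (9 / 4096) * (N : ℝ) = (1 + 2 * (9 / 4096) * N) * (q ^ 2 * (ε ^ 2 * n)) := by
          rw [hqq, mul_one]
      _ = ((1 + 2 * (9 / 4096) * N) * q ^ 2) * (ε ^ 2 * n) := by ring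
      _ ≤ 1 * (ε ^ 2 * n) := by gcongr
      _ = _ := one_mul _
  have h5 : δ * n < 3 / 2 * (N + 1) := by
    have : δ * n < δ * (2 * t * (N + 1)) := by gcongr
    have h6 : (t * δ) * (2 * (N + 1)) ≤ 3 / 4 * (2 * (N + 1)) := by gcongr
    nlinarith
  have h7 : δ * n = 1000 * (ε ^ 2 * n) := by rw [hδ]; ring
  have : (0:ℝ) ≤ N := Nat.cast_nonneg N
  linarith

end LO

theorem lo_mu_test {G : Type u} [Group G] [DecidableEq G] (n : ℕ) (A : Fin n → G) (μ : G → ℝ)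
    (hμ : ∀ x : G, μ x = (1 / (2 * (n : ℝ))) *
        (((Finset.univ.filter fun i => A i = x).card : ℝ) +
          ((Finset.univ.filter fun i => (A i)⁻¹ = x).card : ℝ))) (φ : G → ℝ) :
    ∑' x, μ x * φ x = (1 / (2 * (n : ℝ))) * ∑ i, (φ (A i) + φ (A i)⁻¹) := by
  have h : ∀ x, μ x * φ x = ∑ i : Fin n, (1 / (2 * (n : ℝ))) *
      ((if x = A i then φ (A i) else 0) + (if x = (A i)⁻¹ then φ (A i)⁻¹ else 0)) := by
    intro x
    rw [hμ x, Finset.card_filter, Finset.card_filter, ← Finset.mul_sum, mul_assoc]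
    congr 1
    push_cast
    rw [add_mul, Finset.sum_mul, Finset.sum_mul, ← Finset.sum_add_distrib]
    apply Finset.sum_congr rfl
    intro i _
    congr 1
    · by_cases h : A i = x
      · simp [h]
      · simp [h, Ne.symm h]
    · by_cases h : (A i)⁻¹ = x
      · simp [h]
      · simp [h, Ne.symm h]
  have s : ∀ a : G, Summable (fun x => if x = a then φ a else 0) := fun a =>
    (hasSum_ite_eq a (φ a)).summable
  simp_rw [h]
  rw [Summable.tsum_finsetSum (fun i _ => ((s _).add (s _)).mul_left _), Finset.mul_sum]
  apply Finset.sum_congr rfl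
  intro i _
  rw [tsum_mul_left, Summable.tsum_add (s _) (s _), tsum_ite_eq, tsum_ite_eq]


/-- **Symmetrised nonabelian inverse Littlewood–Offord theorem** (Theorem 1.20 of Tao,
"Inverse theorems for sets and measures of polynomial growth"): if `A'₁ ⋯ A'ₙ` is a product of
`n` i.i.d. random elements uniform among `A₁,…,Aₙ,A₁⁻¹,…,Aₙ⁻¹` and some value is attained with
probability greater than `1/(ε√n)`, with `n ≥ C/ε⁴`, then there is a finite subgroup `H` of
order at most `Cε√n` containing at least `(1 − Cε²)n` of the `Aᵢ`. -/
theorem symmetrised_inverse_littlewood_offord :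
    ∃ C : ℝ, ∀ (G : Type u) [Group G] [DecidableEq G] (n : ℕ) (ε : ℝ) (A : Fin n → G)
      (μ : G → ℝ),
      2 ≤ n → 0 < ε → ε ≤ 1 → C / ε ^ 4 ≤ (n : ℝ) →
      (∀ x : G, μ x = (1 / (2 * (n : ℝ))) *
        (((Finset.univ.filter fun i => A i = x).card : ℝ) +
          ((Finset.univ.filter fun i => (A i)⁻¹ = x).card : ℝ))) →
      (∃ B : G, 1 / (ε * Real.sqrt n) < mconvPow μ n B) →
      ∃ H : Subgroup G, (H : Set G).Finite ∧ (Nat.card H : ℝ) ≤ C * ε * Real.sqrt n ∧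
        (1 - C * ε ^ 2) * (n : ℝ) ≤ (Nat.card { i : Fin n // A i ∈ H } : ℝ) := by
  refine ⟨2000, ?_⟩
  intro G _ _ n ε A μ hn hε hε1 hnε hμ ⟨B, hB⟩
  have hnR : (2:ℝ) ≤ n := by exact_mod_cast hn
  by_contra hcon
  push Not at hcon
  have hfin : μ.support.Finite := by
    refine ((Set.finite_range A).union (Set.finite_range fun i => (A i)⁻¹)).subset ?_
    intro x hx
    by_contra hno
    simp only [Set.mem_union, Set.mem_range, not_or, not_exists] at hno
    apply hx
    rw [hμ x, Finset.filter_false_of_mem (fun i _ => hno.1 i),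
      Finset.filter_false_of_mem (fun i _ => hno.2 i)]
    simp
  have h0 : ∀ x, 0 ≤ μ x := by intro x; rw [hμ x]; positivity
  have h1 : ∑' x, μ x = 1 := by
    have := lo_mu_test n A μ hμ (fun _ => 1)
    simp only [mul_one] at this
    rw [this]
    simp
    field_simp
    norm_num
  have hs : ∀ x, μ x⁻¹ = μ x := by
    intro x
    rw [hμ x, hμ x⁻¹]
    simp only [inv_inj]
    have : ∀ i, A i = x⁻¹ ↔ (A i)⁻¹ = x := fun i => by rw [inv_eq_iff_eq_inv]
    simp_rw [this]
    rw [add_comm]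
  by_cases hbig : 1 ≤ 2000 * ε ^ 2
  · have := hcon ⊥ (by simp) (by
      have hc : (Nat.card (⊥ : Subgroup G) : ℝ) = 1 := by simp
      rw [hc]
      have : 1 ≤ Real.sqrt n := by rw [Real.one_le_sqrt]; linarith
      nlinarith)
    have h3 : (0:ℝ) ≤ (Nat.card { i : Fin n // A i ∈ (⊥ : Subgroup G) } : ℝ) := Nat.cast_nonneg _
    nlinarith
  push Not at hbig
  refine lo_core hfin h0 h1 hs n (by omega) ε hε hbig ?_ B hB
  intro H hHf hHc
  have h2 := hcon H hHf hHc
  rw [lo_mu_test n A μ hμ]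
  have h3 : ∀ i, loInd (H : Set G) (A i) + loInd (H : Set G) (A i)⁻¹ =
      2 * loInd (H : Set G) (A i) := by
    intro i
    by_cases h : A i ∈ (H : Set G)
    · rw [loInd_mem h, loInd_mem (H.inv_mem h)]; norm_num
    · rw [loInd_not h, loInd_not (fun h' => h (by simpa using h'))]; norm_num
  have h4 : ∑ i, loInd (H : Set G) (A i) = (Nat.card { i : Fin n // A i ∈ H } : ℝ) := by
    classical
    rw [Nat.card_eq_fintype_card, Fintype.card_subtype, Finset.card_filter]
    push_cast
    apply Finset.sum_congr rfl
    intro i _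
    simp [loInd, Set.indicator_apply]
  simp_rw [h3]
  rw [← Finset.mul_sum, h4]
  calc _ = (Nat.card { i : Fin n // A i ∈ H } : ℝ) / n := by field_simp
    _ < _ := by rw [div_lt_iff₀ (by linarith)]; exact h2
end

section
/- There is an absolute constant C ≥ 1 with the following property. Let G be a group, let n ≥ 2 be a natural number, and let s be a positive integer with s ≥ C·n^{1/4}. Let A_1,…,A_n ∈ G be elements each of order at least s (that is, for each i, either A_i has infinite order or orderOf(A_i) ≥ s). Let μ : G → [0,∞) be the probability measure μ(x) := (1/(2n))·(#{i : A_i = x} + #{i : A_i⁻¹ = x}). Then sup_{B∈G} μ^{*n}(B) ≤ C/min(s, √n). -/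
universe u

lemma slo_tsum {G : Type u} (f : G →₀ ℝ) (h : G → ℝ) :
    HasSum (fun y => f y * h y) (f.sum fun y r => r * h y) := by
  apply hasSum_sum_of_ne_finset_zero
  intro b hb
  simp [Finsupp.notMem_support_iff.mp hb]

lemma slo_mul {G : Type u} [Group G] (a b : MonoidAlgebra ℝ G) (x : G) :
    HasSum (fun y => a.coeff y * b.coeff (y⁻¹ * x)) ((a * b).coeff x) := by
  rw [MonoidAlgebra.coeff_mul_apply_left]
  exact slo_tsum a.coeff (fun y => b.coeff (y⁻¹ * x))

lemma slo_pow {G : Type u} [Group G] [DecidableEq G] (p : MonoidAlgebra ℝ G) (n : ℕ) :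
    mconvPow (fun x => p.coeff x) n = fun x => (p ^ n).coeff x := by
  induction n with
  | zero => funext x; simp [mconvPow, MonoidAlgebra.one_def, Finsupp.single_apply, eq_comm]
  | succ n ih =>
    funext x
    simp only [mconvPow, ih, mconv, pow_succ']
    exact (slo_mul p (p ^ n) x).tsum_eq

def SloSym {G : Type u} [Group G] (a : MonoidAlgebra ℝ G) : Prop :=
  ∀ x, a.coeff x⁻¹ = a.coeff x

lemma slo_sym_mul {G : Type u} [Group G] {a b : MonoidAlgebra ℝ G} (ha : SloSym a)
    (hb : SloSym b) (hc : a * b = b * a) : SloSym (a * b) := by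
  intro x
  conv_rhs => rw [hc]
  have h1 := slo_mul a b x⁻¹
  have h2 := slo_mul b a x
  refine h1.unique ?_
  rw [← (Equiv.mulLeft x).hasSum_iff] at h2
  convert h2 using 2 with y
  simp only [Function.comp, Equiv.coe_mulLeft, mul_inv_rev,
    inv_mul_cancel_right]
  rw [← hb (x * y), mul_comm]
  simp [ha y]

lemma slo_sym_pow {G : Type u} [Group G] {a : MonoidAlgebra ℝ G} (ha : SloSym a) (k : ℕ) :
    SloSym (a ^ k) := by
  induction k with
  | zero =>
    intro x; classical
    simp [MonoidAlgebra.one_def, Finsupp.single_apply, eq_comm]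
  | succ k ih =>
    rw [pow_succ]; exact slo_sym_mul ih ha (by rw [← pow_succ, ← pow_succ'])

/-- Dirichlet form. -/
lemma slo_diff {G : Type u} [Group G] {f : MonoidAlgebra ℝ G} (hf : SloSym f) (w : G) :
    HasSum (fun y => (f.coeff y - f.coeff (w * y)) ^ 2)
      (2 * ((f * f).coeff 1 - (f * f).coeff w)) := by
  have hg : (f * f).coeff w = (f * f).coeff w⁻¹ := (slo_sym_mul hf hf rfl w).symm
  rw [hg]
  have h1 := slo_mul f f 1
  have h2 := slo_mul f f w⁻¹
  have h3 := h1
  rw [← (Equiv.mulLeft w).hasSum_iff] at h3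
  have h4 := (h1.add h3).add (h2.mul_left (-2))
  have e : (fun y => (f.coeff y - f.coeff (w * y)) ^ 2) = (fun y => (f.coeff y * f.coeff (y⁻¹ * 1) +
      ((fun y => f.coeff y * f.coeff (y⁻¹ * 1)) ∘ (Equiv.mulLeft w)) y) +
      (-2) * (f.coeff y * f.coeff (y⁻¹ * w⁻¹))) := by
    funext y
    have e1 : f.coeff (y⁻¹ * w⁻¹) = f.coeff (w * y) := by rw [← hf (w * y)]; simp
    have e2 : f.coeff (y⁻¹ * 1) = f.coeff y := by rw [← hf y]; simp
    have e3 : f.coeff ((w * y)⁻¹ * 1) = f.coeff (w * y) := by rw [← hf (w * y)]; simp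
    simp only [Function.comp, Equiv.coe_mulLeft, e1, e2, e3]
    ring
  rw [e]
  have e' : 2 * ((f * f).coeff 1 - (f * f).coeff w⁻¹) =
    (f * f).coeff 1 + (f * f).coeff 1 + (-2) * (f * f).coeff w⁻¹ := by ring
  rw [e']
  exact h4

lemma slo_le_one {G : Type u} [Group G] {f : MonoidAlgebra ℝ G} (hf : SloSym f) (w : G) :
    (f * f).coeff w ≤ (f * f).coeff 1 := by
  have := (slo_diff hf w).nonneg (fun y => sq_nonneg _)
  linarith

lemma slo_diff_pow {G : Type u} [Group G] {f : MonoidAlgebra ℝ G} (hf : SloSym f) (w : G) (j : ℕ) :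
    (f * f).coeff 1 - (f * f).coeff (w ^ j) ≤
      (j : ℝ) ^ 2 * ((f * f).coeff 1 - (f * f).coeff w) := by
  have h1 := slo_diff hf (w ^ j)
  have h2 : ∀ i ∈ Finset.range j,
      HasSum (fun y => (f.coeff (w ^ i * y) - f.coeff (w ^ (i + 1) * y)) ^ 2)
      (2 * ((f * f).coeff 1 - (f * f).coeff w)) := by
    intro i _
    have := slo_diff hf w
    rw [← (Equiv.mulLeft (w ^ i)).hasSum_iff] at this
    convert this using 2 with y
    simp [pow_succ', mul_assoc]
  have h3 := (hasSum_sum h2).mul_left (j : ℝ)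
  have h4 := hasSum_le (fun y => ?_) h1 h3
  · simp only [Finset.sum_const, Finset.card_range, nsmul_eq_mul] at h4
    nlinarith
  · have h := sq_sum_le_card_mul_sum_sq (s := Finset.range j)
      (f := fun i => f.coeff (w ^ i * y) - f.coeff (w ^ (i + 1) * y))
    rw [Finset.sum_range_sub' (fun i => f.coeff (w ^ i * y))] at h
    simpa using h

/-- Probability elements. -/
def SloProb {G : Type u} [Group G] (a : MonoidAlgebra ℝ G) : Prop :=
  (∀ x, 0 ≤ a.coeff x) ∧ MonoidAlgebra.lift ℝ ℝ G 1 a = 1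

lemma slo_mass {G : Type u} [Group G] (a : MonoidAlgebra ℝ G) :
    HasSum (fun y => a.coeff y) (MonoidAlgebra.lift ℝ ℝ G 1 a) := by
  rw [MonoidAlgebra.lift_apply]
  simpa using slo_tsum a.coeff (fun _ => 1)

lemma slo_prob_mul {G : Type u} [Group G] {a b : MonoidAlgebra ℝ G} (ha : SloProb a)
    (hb : SloProb b) : SloProb (a * b) :=
  ⟨fun x => (slo_mul a b x).nonneg fun y => mul_nonneg (ha.1 _) (hb.1 _),
    by rw [map_mul, ha.2, hb.2, one_mul]⟩

lemma slo_prob_pow {G : Type u} [Group G] {a : MonoidAlgebra ℝ G} (ha : SloProb a) (k : ℕ) :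
    SloProb (a ^ k) := by
  induction k with
  | zero =>
    refine ⟨fun x => ?_, by simp⟩
    classical
    simp only [pow_zero, MonoidAlgebra.one_def, MonoidAlgebra.coeff_single, Finsupp.single_apply]
    split_ifs <;> norm_num
  | succ k ih => rw [pow_succ]; exact slo_prob_mul ih ha

/-- Averaging a function bounded by `c` gives a function bounded by `c`. -/
lemma slo_avg {G : Type u} [Group G] {a b : MonoidAlgebra ℝ G} (ha : SloProb a) {c : ℝ}
    (hb : ∀ x, b.coeff x ≤ c) (x : G) : (a * b).coeff x ≤ c := by
  have h1 := slo_mul a b x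
  have h2 := (slo_mass a).mul_right c
  rw [ha.2, one_mul] at h2
  exact hasSum_le (fun y => mul_le_mul_of_nonneg_left (hb _) (ha.1 _)) h1 h2

lemma slo_coeff_le {G : Type u} [Group G] {a : MonoidAlgebra ℝ G} (ha : SloProb a) (x : G) :
    a.coeff x ≤ 1 := by
  have := le_hasSum (slo_mass a) x (fun y _ => ha.1 y)
  rwa [ha.2] at this

/-- Nash type inequality along one cyclic group. -/
lemma slo_nash {G : Type u} [Group G] {f : MonoidAlgebra ℝ G} (hf : SloSym f) (hp : SloProb f)
    (w : G) (r : ℕ) (hr : 1 ≤ r) (hw : orderOf w = 0 ∨ r ≤ orderOf w) :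
    (f * f).coeff 1 ≤ 1 / r + (r : ℝ) ^ 2 * ((f * f).coeff 1 - (f * f).coeff w) := by
  classical
  have hr0 : (0 : ℝ) < r := by exact_mod_cast hr
  have hinj : Set.InjOn (fun j : ℕ => w ^ j) (Finset.range r : Finset ℕ) := by
    rcases hw with h0 | hle
    · exact (injective_pow_iff_not_isOfFinOrder.mpr (orderOf_eq_zero_iff.mp h0)).injOn
    · refine pow_injOn_Iio_orderOf.mono ?_
      intro j hj
      have : j < r := by simpa using hj
      exact lt_of_lt_of_le this hle
  have hsum : ∑ j ∈ Finset.range r, (f * f).coeff (w ^ j) ≤ 1 := by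
    have hP := slo_prob_mul hp hp
    rw [← Finset.sum_image (f := fun x => (f * f).coeff x) hinj]
    have := sum_le_hasSum ((Finset.range r).image fun j : ℕ => w ^ j) (fun y _ => hP.1 y)
      (slo_mass (f * f))
    rwa [hP.2] at this
  have hD : 0 ≤ (f * f).coeff 1 - (f * f).coeff w := sub_nonneg.mpr (slo_le_one hf w)
  have h2 : ∑ j ∈ Finset.range r, ((f * f).coeff 1 - (f * f).coeff (w ^ j)) ≤
      ∑ j ∈ Finset.range r, (r : ℝ) ^ 2 * ((f * f).coeff 1 - (f * f).coeff w) := by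
    refine Finset.sum_le_sum fun j hj => (slo_diff_pow hf w j).trans ?_
    have : (j : ℝ) ≤ r := by exact_mod_cast (Finset.mem_range.mp hj).le
    gcongr
  rw [Finset.sum_sub_distrib] at h2
  simp only [Finset.sum_const, Finset.card_range, nsmul_eq_mul] at h2
  have h3 : (r : ℝ) * (f * f).coeff 1 ≤
      r * (1 / r + (r : ℝ) ^ 2 * ((f * f).coeff 1 - (f * f).coeff w)) := by
    rw [mul_add, mul_one_div_cancel hr0.ne']; linarith
  exact le_of_mul_le_mul_left h3 hr0

/-- Real recursion. -/
lemma slo_rec (u : ℕ → ℝ) (s : ℕ) (hs : 1 ≤ s) (h0 : ∀ k, 0 ≤ u k) (h1 : ∀ k, u k ≤ 1)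
    (hu : ∀ k r : ℕ, 1 ≤ r → r ≤ s → u (k + 1) ≤ u k - (u k - 1 / r) / (2 * r ^ 2))
    (hmono : ∀ k, u (k + 1) ≤ u k) (k : ℕ) :
    u k ≤ 2 / s ∨ u k ^ 2 * (k + 18) ≤ 18 := by
  have hs0 : (0 : ℝ) < s := by exact_mod_cast hs
  induction k with
  | zero => right; have := h0 0; have := h1 0; push_cast; nlinarith
  | succ k ih =>
    by_cases hk : u k ≤ 2 / s
    · left; exact (hmono k).trans hk
    right
    have ih := ih.resolve_left hk
    push Not at hk
    have hup : 0 < u k := lt_trans (by positivity) hk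
    set r := ⌈2 / u k⌉₊ with hrdef
    have hr1 : 1 ≤ r := Nat.one_le_iff_ne_zero.mpr (Nat.ceil_pos.mpr (by positivity)).ne'
    have hrs : r ≤ s := by
      apply Nat.ceil_le.mpr
      rw [div_le_iff₀ hup]; rw [div_lt_iff₀ hs0] at hk; linarith
    have hr0 : (0 : ℝ) < r := by exact_mod_cast hr1
    have hrl : 2 / u k ≤ r := Nat.le_ceil _
    have hru : (r : ℝ) ≤ 3 / u k := by
      have a := (Nat.ceil_lt_add_one (show 0 ≤ 2 / u k by positivity)).le
      have b : 1 ≤ 1 / u k := by rw [le_div_iff₀ hup]; linarith [h1 k]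
      have : 3 / u k = 2 / u k + 1 / u k := by ring
      linarith
    have e1 : 1 / (r : ℝ) ≤ u k / 2 := by
      rw [div_le_div_iff₀ hr0 two_pos]; rw [div_le_iff₀ hup] at hrl; linarith
    have e2 : u k ^ 3 / 36 ≤ (u k - 1 / r) / (2 * r ^ 2) := by
      rw [le_div_iff₀ (by positivity)]
      have e3 : u k * r ≤ 3 := by rw [le_div_iff₀ hup] at hru; linarith
      have e4 : (u k * r) ^ 2 ≤ 9 := by
        have : 0 ≤ u k * r := by positivity
        nlinarith
      have : u k ^ 3 / 36 * (2 * (r : ℝ) ^ 2) = u k / 18 * (u k * r) ^ 2 := by ring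
      rw [this]
      nlinarith
    have h := hu k r hr1 hrs
    have h' : u (k + 1) ≤ u k * (1 - u k ^ 2 / 36) := by nlinarith
    have hsq : u (k + 1) ^ 2 ≤ (u k * (1 - u k ^ 2 / 36)) ^ 2 := pow_le_pow_left₀ (h0 _) h' 2
    set v := u k ^ 2 with hv
    have hv0 : 0 ≤ v := sq_nonneg _
    have hv1 : v ≤ 1 := by rw [hv]; nlinarith [h1 k]
    push_cast
    calc u (k + 1) ^ 2 * ((k : ℝ) + 1 + 18)
        ≤ (u k * (1 - v / 36)) ^ 2 * ((k : ℝ) + 1 + 18) := by gcongr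
      _ = (v * (k + 18) + v) * (1 - v / 36) ^ 2 := by rw [mul_pow, ← hv]; ring
      _ ≤ (18 + v) * (1 - v / 36) ^ 2 := by gcongr
      _ ≤ 18 * ((1 + v / 36) * (1 - v / 36)) ^ 2 := by
          rw [mul_pow, ← mul_assoc]; gcongr; nlinarith
      _ ≤ 18 := by
          have a : (1 + v / 36) * (1 - v / 36) ≤ 1 := by nlinarith
          have b : 0 ≤ (1 + v / 36) * (1 - v / 36) := by
            apply mul_nonneg <;> linarith
          nlinarith

lemma slo_even_mono {G : Type u} [Group G] {P : MonoidAlgebra ℝ G} (hs : SloSym P) (hp : SloProb P)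
    (i k : ℕ) : (P ^ (2 * (i + k))).coeff 1 ≤ (P ^ (2 * i)).coeff 1 := by
  have e : P ^ (2 * (i + k)) = P ^ (2 * k) * (P ^ i * P ^ i) := by
    rw [← pow_add, ← pow_add]; congr 1; ring
  have e2 : P ^ (2 * i) = P ^ i * P ^ i := by rw [← pow_add]; congr 1; ring
  rw [e, e2]
  exact slo_avg (slo_prob_pow hp _) (slo_le_one (slo_sym_pow hs i)) 1

lemma slo_sup {G : Type u} [Group G] {P : MonoidAlgebra ℝ G} (hs : SloSym P) (hp : SloProb P)
    (m t : ℕ) (B : G) : (P ^ (t + 2 * m)).coeff B ≤ (P ^ (2 * m)).coeff 1 := by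
  have e2 : P ^ (2 * m) = P ^ m * P ^ m := by rw [← pow_add]; congr 1; ring
  rw [pow_add, e2]
  exact slo_avg (slo_prob_pow hp _) (slo_le_one (slo_sym_pow hs m)) B

lemma slo_choose (k : ℕ) (hk : 1 ≤ k) :
    ∑ j ∈ Finset.range (2 * k + 1), ((1 + (-1 : ℝ) ^ j) / 2) * ((2 * k).choose j : ℝ)
      = 2 ^ (2 * k) / 2 := by
  have h1 := add_pow (1 : ℝ) 1 (2 * k)
  have h2 := add_pow (-1 : ℝ) 1 (2 * k)
  simp only [one_pow, one_mul, mul_one] at h1 h2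
  have h3 : (-1 + 1 : ℝ) ^ (2 * k) = 0 := by
    rw [neg_add_cancel]; exact zero_pow (by omega)
  rw [h3] at h2
  have : ∀ j ∈ Finset.range (2 * k + 1), ((1 + (-1 : ℝ) ^ j) / 2) * ((2 * k).choose j : ℝ)
      = ((2 * k).choose j : ℝ) / 2 + ((-1 : ℝ) ^ j * ((2 * k).choose j : ℝ)) / 2 := by
    intro j _; ring
  rw [Finset.sum_congr rfl this, Finset.sum_add_distrib, ← Finset.sum_div, ← Finset.sum_div,
    ← h1, ← h2]
  norm_num

noncomputable def sloLazy {G : Type u} [Group G] (P : MonoidAlgebra ℝ G) : MonoidAlgebra ℝ G :=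
  (1 / 2 : ℝ) • (P + 1)

lemma slo_lazy_le {G : Type u} [Group G] {P : MonoidAlgebra ℝ G} (hs : SloSym P) (hp : SloProb P)
    (k : ℕ) (hk : 1 ≤ k) :
    (P ^ (2 * k)).coeff 1 ≤ 2 * (sloLazy P ^ k * sloLazy P ^ k).coeff 1 := by
  have e : sloLazy P ^ k * sloLazy P ^ k = (1 / 2 : ℝ) ^ (2 * k) •
      ∑ j ∈ Finset.range (2 * k + 1), ((2 * k).choose j : ℝ) • P ^ j := by
    rw [← pow_add, ← two_mul, sloLazy, smul_pow, (Commute.one_right P).add_pow]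
    congr 1
    refine Finset.sum_congr rfl fun j _ => ?_
    rw [one_pow, mul_one, ← nsmul_eq_mul', Nat.cast_smul_eq_nsmul]
  have e2 : (sloLazy P ^ k * sloLazy P ^ k).coeff 1 = (1 / 2 : ℝ) ^ (2 * k) *
      ∑ j ∈ Finset.range (2 * k + 1), ((2 * k).choose j : ℝ) * (P ^ j).coeff 1 := by
    rw [e, MonoidAlgebra.coeff_smul_apply, MonoidAlgebra.coeff_sum, Finsupp.finsetSum_apply]
    simp
  have h : ∑ j ∈ Finset.range (2 * k + 1), ((1 + (-1 : ℝ) ^ j) / 2) * ((2 * k).choose j : ℝ) *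
      (P ^ (2 * k)).coeff 1 ≤
      ∑ j ∈ Finset.range (2 * k + 1), ((2 * k).choose j : ℝ) * (P ^ j).coeff 1 := by
    refine Finset.sum_le_sum fun j hj => ?_
    have hj' : j < 2 * k + 1 := Finset.mem_range.mp hj
    rcases Nat.even_or_odd' j with ⟨i, rfl | rfl⟩
    · have := slo_even_mono hs hp i (k - i)
      rw [show i + (k - i) = k by omega] at this
      have e : (1 + (-1 : ℝ) ^ (2 * i)) / 2 = 1 := by rw [pow_mul]; norm_num
      rw [e, one_mul]; gcongr
    · have e : (1 + (-1 : ℝ) ^ (2 * i + 1)) / 2 = 0 := by rw [pow_succ, pow_mul]; norm_num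
      rw [e, zero_mul, zero_mul]
      exact mul_nonneg (Nat.cast_nonneg _) ((slo_prob_pow hp _).1 _)
  rw [← Finset.sum_mul, slo_choose k hk] at h
  rw [e2]
  calc (P ^ (2 * k)).coeff 1 = 2 * ((1 / 2 : ℝ) ^ (2 * k) *
        (2 ^ (2 * k) / 2 * (P ^ (2 * k)).coeff 1)) := by
          rw [one_div, inv_pow]; field_simp
    _ ≤ _ := by gcongr

lemma slo_lazy_sym {G : Type u} [Group G] {P : MonoidAlgebra ℝ G} (hs : SloSym P) :
    SloSym (sloLazy P) := by
  intro x
  have := slo_sym_pow hs 0 x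
  rw [pow_zero] at this
  simp [sloLazy, hs x, this]

lemma slo_lazy_prob {G : Type u} [Group G] {P : MonoidAlgebra ℝ G} (hp : SloProb P) :
    SloProb (sloLazy P) := by
  constructor
  · intro x
    have h1 := (slo_prob_pow hp 0).1 x
    rw [pow_zero] at h1
    have h2 := hp.1 x
    have : (sloLazy P).coeff x = (1 / 2) * (P.coeff x + (1 : MonoidAlgebra ℝ G).coeff x) := by
      simp [sloLazy]; ring
    rw [this]; positivity
  · rw [sloLazy, map_smul, map_add, hp.2, map_one]; norm_num

/-- One step of the lazy walk decreases the return probability by the Dirichlet form. -/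
lemma slo_step {G : Type u} [Group G] {P : MonoidAlgebra ℝ G} (hs : SloSym P) (hp : SloProb P)
    (k : ℕ) :
    (sloLazy P ^ (k + 1) * sloLazy P ^ (k + 1)).coeff 1 ≤
      (sloLazy P ^ k * sloLazy P ^ k).coeff 1 -
      ((sloLazy P ^ k * sloLazy P ^ k).coeff 1 - (P * (sloLazy P ^ k * sloLazy P ^ k)).coeff 1) / 2
      := by
  set g := sloLazy P ^ k * sloLazy P ^ k with hg
  have e : sloLazy P ^ (k + 1) * sloLazy P ^ (k + 1) =
      (1 / 4 : ℝ) • (P ^ 2 * g) + (1 / 2 : ℝ) • (P * g) + (1 / 4 : ℝ) • g := by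
    have : sloLazy P ^ (k + 1) * sloLazy P ^ (k + 1) = sloLazy P ^ 2 * g := by
      rw [hg, ← pow_add, ← pow_add, ← pow_add]; congr 1; ring
    rw [this, sloLazy, smul_pow, smul_mul_assoc]
    have h2 : (P + 1) ^ 2 = P ^ 2 + (2 : ℝ) • P + 1 := by
      rw [two_smul]; noncomm_ring
    rw [h2, add_mul, add_mul, one_mul, smul_mul_assoc, smul_add, smul_add, smul_smul]
    norm_num
  have h := slo_avg (slo_prob_pow hp 2) (slo_le_one (slo_sym_pow (slo_lazy_sym hs) k)) 1
  rw [← hg] at h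
  have e2 : (sloLazy P ^ (k + 1) * sloLazy P ^ (k + 1)).coeff 1 =
      (1 / 4 : ℝ) * (P ^ 2 * g).coeff 1 + (1 / 2 : ℝ) * (P * g).coeff 1
        + (1 / 4 : ℝ) * g.coeff 1 := by
    rw [e]; simp
  rw [e2]; linarith

noncomputable def sloP {G : Type u} [Group G] {n : ℕ} (A : Fin n → G) : MonoidAlgebra ℝ G :=
  ∑ i, (MonoidAlgebra.single (A i) (1 / (2 * (n : ℝ))) +
    MonoidAlgebra.single (A i)⁻¹ (1 / (2 * (n : ℝ))))

lemma sloP_coeff {G : Type u} [Group G] [DecidableEq G] {n : ℕ} (A : Fin n → G) (x : G) :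
    (sloP A).coeff x = (1 / (2 * (n : ℝ))) *
        (((Finset.univ.filter fun i => A i = x).card : ℝ) +
          ((Finset.univ.filter fun i => (A i)⁻¹ = x).card : ℝ)) := by
  rw [sloP, MonoidAlgebra.coeff_sum, Finsupp.finsetSum_apply]
  simp only [MonoidAlgebra.coeff_add, MonoidAlgebra.coeff_single, Finsupp.add_apply,
    Finsupp.single_apply, Finset.sum_add_distrib, Finset.card_filter, Nat.cast_sum, mul_add,
    Finset.mul_sum, Nat.cast_ite, Nat.cast_one, Nat.cast_zero, mul_ite, mul_one, mul_zero]

lemma sloP_sym {G : Type u} [Group G] {n : ℕ} (A : Fin n → G) : SloSym (sloP A) := by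
  classical
  intro x
  rw [sloP_coeff, sloP_coeff, add_comm]
  simp only [inv_eq_iff_eq_inv]
  simp

lemma sloP_prob {G : Type u} [Group G] {n : ℕ} (hn : 1 ≤ n) (A : Fin n → G) :
    SloProb (sloP A) := by
  classical
  constructor
  · intro x; rw [sloP_coeff]; positivity
  · have : (n : ℝ) ≠ 0 := by positivity
    simp [sloP, MonoidAlgebra.lift_single]
    field_simp
    norm_num

lemma sloP_nash {G : Type u} [Group G] {n : ℕ} (hn : 1 ≤ n) (A : Fin n → G)
    {f : MonoidAlgebra ℝ G} (hf : SloSym f) (hp : SloProb f)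
    (r : ℕ) (hr : 1 ≤ r) (hw : ∀ i, orderOf (A i) = 0 ∨ r ≤ orderOf (A i)) :
    (f * f).coeff 1 ≤ 1 / r + (r : ℝ) ^ 2 * ((f * f).coeff 1 - (sloP A * (f * f)).coeff 1) := by
  have hn0 : (0 : ℝ) < n := by exact_mod_cast hn
  have e : (sloP A * (f * f)).coeff 1 = ∑ i, (1 / (n : ℝ)) * (f * f).coeff (A i) := by
    rw [sloP, Finset.sum_mul, MonoidAlgebra.coeff_sum, Finsupp.finsetSum_apply]
    refine Finset.sum_congr rfl fun i _ => ?_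
    rw [add_mul, MonoidAlgebra.coeff_add, Finsupp.add_apply, MonoidAlgebra.coeff_single_mul_apply,
      MonoidAlgebra.coeff_single_mul_apply, mul_one, mul_one, inv_inv,
      slo_sym_mul hf hf rfl (A i)]
    field_simp
    ring
  have h := Finset.sum_le_sum (s := (Finset.univ : Finset (Fin n)))
    fun i _ => slo_nash hf hp (A i) r hr (hw i)
  rw [Finset.sum_add_distrib, ← Finset.mul_sum, Finset.sum_sub_distrib] at h
  rw [← Finset.mul_sum] at e
  rw [e]
  simp only [Finset.sum_const, Finset.card_univ, Fintype.card_fin, nsmul_eq_mul] at h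
  refine le_of_mul_le_mul_left (h.trans_eq ?_) hn0
  field_simp

lemma slo_u {G : Type u} [Group G] {n : ℕ} (hn : 1 ≤ n) (A : Fin n → G) (s : ℕ) (hs : 1 ≤ s)
    (hw : ∀ i, orderOf (A i) = 0 ∨ s ≤ orderOf (A i)) (k : ℕ) :
    (sloLazy (sloP A) ^ k * sloLazy (sloP A) ^ k).coeff 1 ≤ 2 / s ∨
    (sloLazy (sloP A) ^ k * sloLazy (sloP A) ^ k).coeff 1 ^ 2 * (k + 18) ≤ 18 := by
  have hS := sloP_sym A
  have hP := sloP_prob hn A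
  have hp := fun k => slo_prob_pow (slo_lazy_prob hP) k
  have hsy := fun k => slo_sym_pow (slo_lazy_sym hS) k
  refine slo_rec (fun k => (sloLazy (sloP A) ^ k * sloLazy (sloP A) ^ k).coeff 1) s hs
    (fun k => (slo_prob_mul (hp k) (hp k)).1 1) (fun k => slo_coeff_le (slo_prob_mul (hp k) (hp k)) 1)
    (fun k r hr hrs => ?_) (fun k => ?_) k
  · have h1 := sloP_nash hn A (hsy k) (hp k) r hr (fun i => (hw i).imp id fun h => hrs.trans h)
    have h2 := slo_step hS hP k
    refine h2.trans (sub_le_sub_left ?_ _)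
    have hr0 : (0 : ℝ) < r := by exact_mod_cast hr
    rw [div_le_div_iff₀ (by positivity) two_pos]
    linarith
  · have h2 := slo_step hS hP k
    have h3 := slo_avg hP (slo_le_one (hsy k)) 1
    linarith

/-- A symmetrised analogue of the Tiep–Vu nonabelian Littlewood–Offord theorem, in the regime
`s ≥ C n^{1/4}` (a consequence of Theorem 1.20 of Tao, "Inverse theorems for sets and measures
of polynomial growth"): if each `Aᵢ` has order at least `s` (possibly infinite) then the random
walk `A'₁ ⋯ A'ₙ` by i.i.d. steps uniform among `A₁,…,Aₙ,A₁⁻¹,…,Aₙ⁻¹` concentrates at no point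
with probability more than `C / min(s, √n)`. -/
theorem symmetrised_littlewood_offord_large_order :
    ∃ C : ℝ, 1 ≤ C ∧
    ∀ (G : Type u) [Group G] [DecidableEq G] (n s : ℕ) (A : Fin n → G) (μ : G → ℝ),
      2 ≤ n → 1 ≤ s → C * (n : ℝ) ^ ((1 : ℝ) / 4) ≤ (s : ℝ) →
      (∀ i, orderOf (A i) = 0 ∨ s ≤ orderOf (A i)) →
      (∀ x : G, μ x = (1 / (2 * (n : ℝ))) *
        (((Finset.univ.filter fun i => A i = x).card : ℝ) +
          ((Finset.univ.filter fun i => (A i)⁻¹ = x).card : ℝ))) →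
      ∀ B : G, mconvPow μ n B ≤ C / min (s : ℝ) (Real.sqrt n) := by
  refine ⟨15, by norm_num, ?_⟩
  intro G _ _ n s A μ hn hs _ hw hμ B
  have hs0 : (0 : ℝ) < s := by exact_mod_cast hs
  have hn0 : (0 : ℝ) < n := by positivity
  have hsq0 : 0 < Real.sqrt n := Real.sqrt_pos.mpr hn0
  have hμ' : μ = fun x => (sloP A).coeff x := by
    funext x; rw [hμ, sloP_coeff]
  rw [hμ', slo_pow]
  have hS := sloP_sym A
  have hP := sloP_prob (by omega) A
  obtain ⟨m, t, hm, ht, hnm⟩ : ∃ m t : ℕ, 1 ≤ m ∧ t ≤ 1 ∧ n = t + 2 * m :=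
    ⟨n / 2, n % 2, by omega, by omega, by omega⟩
  have h1 : ((sloP A) ^ n).coeff B ≤ ((sloP A) ^ (2 * m)).coeff 1 := by
    have := slo_sup hS hP m t B
    rwa [← hnm] at this
  have h2 := slo_lazy_le hS hP m hm
  have h3 := slo_u (by omega) A s hs hw m
  set v := (sloLazy (sloP A) ^ m * sloLazy (sloP A) ^ m).coeff 1
  have hmin : 0 < min (s : ℝ) (Real.sqrt n) := lt_min hs0 hsq0
  refine (h1.trans h2).trans ?_
  rw [le_div_iff₀ hmin]
  rcases h3 with h3 | h3
  · rw [le_div_iff₀ hs0] at h3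
    have hv : 0 ≤ v := by linarith [(slo_prob_pow hP (2 * m)).1 1]
    calc 2 * v * min (s : ℝ) (Real.sqrt n) ≤ 2 * v * s := by gcongr; exact min_le_left _ _
      _ ≤ 15 := by linarith
  · have hv : 0 ≤ v := by linarith [(slo_prob_pow hP (2 * m)).1 1]
    have hn3 : (n : ℝ) ≤ 3 * m := by
      have : n ≤ 3 * m := by omega
      exact_mod_cast this
    calc 2 * v * min (s : ℝ) (Real.sqrt n) ≤ 2 * v * Real.sqrt n := by
          gcongr; exact min_le_right _ _
      _ ≤ 15 := by
          refine abs_le_of_sq_le_sq' ?_ (by norm_num) |>.2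
          rw [mul_pow, Real.sq_sqrt hn0.le]
          nlinarith [mul_le_mul_of_nonneg_left hn3 (sq_nonneg v), sq_nonneg v]
end

section
/- Let G be an abelian group (written additively), let n ≥ 1, and let μ_1,…,μ_n be symmetric discrete probability measures on G. Define the symmetric probability measure μ := (1/2)·δ_0 + (1/(2n))·(μ_1*μ_1 + ⋯ + μ_n*μ_n), and for each j define μ̃_j := e^{−1/2}·δ_0 + (1 − e^{−1/2})·(μ_j*μ_j), where δ_0 is the point mass at 0. Then sup_{x∈G} (μ_1*⋯*μ_n)(x) ≤ μ^{*n}(0) ≤ (μ̃_1*⋯*μ̃_n)(0). -/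
set_option linter.unusedSectionVars false
set_option linter.style.haveILetI false
universe u

/-- The convolution `μ * ν (x) = ∑_y μ(y) ν(x − y)` of discrete measures on an abelian
group. -/
noncomputable def aconv {G : Type u} [AddCommGroup G] (μ ν : G → ℝ) : G → ℝ :=
  fun x => ∑' y, μ y * ν (x - y)

/-- The iterated convolution `μ₁ * ⋯ * μ_k` of a list of discrete measures on an abelian
group (the empty convolution being the point mass `δ₀` at `0`). -/
noncomputable def aconvList {G : Type u} [AddCommGroup G] [DecidableEq G] :
    List (G → ℝ) → G → ℝ
  | [] => fun x => if x = 0 then 1 else 0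
  | μ :: l => aconv μ (aconvList l)


open MeasureTheory in
structure CharSys (G : Type u) [AddCommGroup G] [DecidableEq G] (D : Type u)
    [TopologicalSpace D] [MeasurableSpace D] (P : Measure D) (e : G → D → ℂ) : Prop where
  cont : ∀ x, Continuous (e x)
  add : ∀ x y d, e (x + y) d = e x d * e y d
  nrm : ∀ x d, ‖e x d‖ = 1
  neg : ∀ x d, e (-x) d = (starRingEnd ℂ) (e x d)
  int : ∀ x, ∫ d, e x d ∂P = if x = 0 then 1 else 0

open MeasureTheory in
theorem exists_charSys (G : Type u) [AddCommGroup G] [DecidableEq G] :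
    ∃ (D : Type u) (_ : TopologicalSpace D) (_ : MeasurableSpace D) (_ : BorelSpace D)
      (_ : CompactSpace D) (P : Measure D) (_ : IsProbabilityMeasure P) (e : G → D → ℂ),
      CharSys G D P e := by
  letI : TopologicalSpace G := ⊥
  haveI : DiscreteTopology G := ⟨rfl⟩
  haveI : DiscreteTopology (Multiplicative G) := ⟨rfl⟩
  let D := PontryaginDual (Multiplicative G)
  letI : MeasurableSpace D := borel D
  haveI : BorelSpace D := ⟨rfl⟩
  let P : Measure D := Measure.haarMeasure ⊤
  haveI : IsProbabilityMeasure P := ⟨by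
    simpa using Measure.haarMeasure_self (K₀ := (⊤ : TopologicalSpace.PositiveCompacts D))⟩
  have hneg : ∀ (x : G) (d : D), ((d (Multiplicative.ofAdd (-x)) : Circle) : ℂ)
      = (starRingEnd ℂ) (d (Multiplicative.ofAdd x) : Circle) := by
    intro x d
    rw [ofAdd_neg, map_inv, Circle.coe_inv_eq_conj]
  refine ⟨D, inferInstance, inferInstance, inferInstance, inferInstance, P, inferInstance,
    fun x d => ((d (Multiplicative.ofAdd x) : Circle) : ℂ), ?_, ?_, ?_, hneg, ?_⟩
  · intro x
    refine continuous_subtype_val.comp ?_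
    have h1 : Continuous (fun d : D => (ContinuousMonoidHom.toContinuousMap d)) :=
      (ContinuousMonoidHom.isInducing_toContinuousMap (Multiplicative G) Circle).continuous
    exact (continuous_eval_const (F := C(Multiplicative G, Circle)) (Multiplicative.ofAdd x)).comp h1
  · intro x y d
    rw [ofAdd_add, map_mul, Circle.coe_mul]
  · intro x d
    exact Circle.norm_coe _
  · intro x
    split_ifs with hx
    · subst hx
      simp
    · obtain ⟨c, hc⟩ := CharacterModule.exists_character_apply_ne_zero_of_ne_zero hx
      obtain ⟨d0, hd0⟩ : ∃ d0 : D, (d0 (Multiplicative.ofAdd x) : Circle) ≠ 1 := by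
        have hφ : AddSubgroup.zmultiples (1 : ℚ) ≤
            (AddSubgroup.zmultiples (1 : ℝ)).comap (Rat.castHom ℝ).toAddMonoidHom := by
          rw [AddSubgroup.zmultiples_le]
          exact AddSubgroup.mem_comap.2 (by simp)
        let φ : AddCircle (1 : ℚ) →+ AddCircle (1 : ℝ) :=
          QuotientAddGroup.map _ _ (Rat.castHom ℝ).toAddMonoidHom hφ
        have hinj : ∀ q, φ q = 0 → q = 0 := by
          intro q
          induction q using QuotientAddGroup.induction_on with
          | H z =>
            intro hz
            have hz' : ((z : ℝ) : AddCircle (1 : ℝ)) = 0 := hz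
            rw [AddCircle.coe_eq_zero_iff] at hz'
            obtain ⟨m, hm⟩ := hz'
            refine (AddCircle.coe_eq_zero_iff (1 : ℚ)).2 ⟨m, ?_⟩
            simp only [zsmul_eq_mul, mul_one] at hm ⊢
            exact_mod_cast hm
        let d1 : Multiplicative G →ₜ* Circle :=
          { toFun := fun y => AddCircle.toCircle (φ (c (Multiplicative.toAdd y)))
            map_one' := by simp
            map_mul' := fun y z => by simp [AddCircle.toCircle_add]
            continuous_toFun := continuous_of_discreteTopology }
        refine ⟨d1, fun h => hc (hinj _ ?_)⟩
        apply AddCircle.injective_toCircle one_ne_zero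
        rw [AddCircle.toCircle_zero]
        exact h
      have hinv := integral_mul_left_eq_self (μ := P)
        (fun d : D => ((d (Multiplicative.ofAdd x) : Circle) : ℂ)) d0
      have hmul : ∀ d : D, (((d0 * d) (Multiplicative.ofAdd x) : Circle) : ℂ)
          = (d0 (Multiplicative.ofAdd x) : Circle) * ((d (Multiplicative.ofAdd x) : Circle) : ℂ) := by
        intro d
        rw [← Circle.coe_mul]
        rfl
      simp_rw [hmul] at hinv
      rw [integral_const_mul] at hinv
      have : (((d0 (Multiplicative.ofAdd x) : Circle) : ℂ) - 1) *
        ∫ d : D, ((d (Multiplicative.ofAdd x) : Circle) : ℂ) ∂P = 0 := by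
        rw [sub_mul, hinv]; ring
      rcases mul_eq_zero.1 this with h | h
      · exfalso
        apply hd0
        ext
        simpa using sub_eq_zero.1 h
      · exact h

noncomputable def ft {G D : Type u} (e : G → D → ℂ) (f : G → ℝ) (d : D) : ℂ :=
  ∑' x, (f x : ℂ) * e x d

theorem aconv_aux {G : Type u} [AddCommGroup G] {f g : G → ℝ}
    (hf : Summable f) (hg : Summable g) :
    Summable (fun p : G × G => f p.2 * g (p.1 - p.2)) := by
  have h := (summable_mul_of_summable_norm (hf.norm) (hg.norm))
  let E : G × G ≃ G × G :=
    ⟨fun p => (p.2, p.1 - p.2), fun p => (p.1 + p.2, p.1), fun p => by simp, fun p => by simp⟩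
  exact (E.summable_iff (f := fun p : G × G => f p.1 * g p.2)).2 h

theorem aconv_summable {G : Type u} [AddCommGroup G] {f g : G → ℝ}
    (hf : Summable f) (hg : Summable g) : Summable (aconv f g) :=
  (aconv_aux hf hg).prod

section
open MeasureTheory
variable {G : Type u} [AddCommGroup G] [DecidableEq G] {D : Type u}
    [TopologicalSpace D] [MeasurableSpace D] [BorelSpace D] [CompactSpace D]
    {P : Measure D} [IsProbabilityMeasure P] {e : G → D → ℂ}

theorem CharSys.zero (H : CharSys G D P e) (d : D) : e 0 d = 1 := by
  have h := H.add 0 0 d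
  have h2 := H.nrm 0 d
  have h3 : e 0 d ≠ 0 := by intro h0; simp [h0] at h2
  rw [add_zero] at h
  exact (mul_eq_left₀ h3).1 h.symm

theorem ft_summable (H : CharSys G D P e) {f : G → ℝ} (hf : Summable f) (d : D) :
    Summable (fun x => (f x : ℂ) * e x d) := by
  apply Summable.of_norm
  simpa [H.nrm] using hf.abs

theorem ft_cont (H : CharSys G D P e) {f : G → ℝ} (hf : Summable f) :
    Continuous (ft e f) := by
  refine continuous_tsum (u := fun x => |f x|) (fun x => (H.cont x).const_smul (f x : ℂ)) hf.abs ?_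
  intro x d
  simp [H.nrm]

theorem ft_norm (H : CharSys G D P e) {f : G → ℝ} (hf : Summable f) (h0 : ∀ x, 0 ≤ f x)
    (h1 : ∑' x, f x = 1) (d : D) : ‖ft e f d‖ ≤ 1 := by
  rw [← h1]
  refine tsum_of_norm_bounded hf.hasSum ?_
  intro x
  simp [H.nrm, abs_of_nonneg (h0 x)]

theorem ft_real (H : CharSys G D P e) {f : G → ℝ} (hs : ∀ x, f (-x) = f x) (d : D) :
    ((ft e f d).re : ℂ) = ft e f d := by
  rw [← Complex.conj_eq_iff_re]
  unfold ft
  rw [Complex.conj_tsum, ← (Equiv.neg G).tsum_eq]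
  refine tsum_congr fun x => ?_
  simp [hs, H.neg]

theorem ft_conv (H : CharSys G D P e) {f g : G → ℝ} (hf : Summable f) (hg : Summable g) (d : D) :
    ft e (aconv f g) d = ft e f d * ft e g d := by
  have hF := ft_summable H hf d
  have hG := ft_summable H hg d
  unfold ft
  rw [tsum_mul_tsum_of_summable_norm hF.norm hG.norm]
  let E : G × G ≃ G × G :=
    ⟨fun p => (p.2, p.1 - p.2), fun p => (p.1 + p.2, p.1), fun p => by simp, fun p => by simp⟩
  have hS := summable_mul_of_summable_norm hF.norm hG.norm
  rw [← E.tsum_eq, Summable.tsum_prod (by exact E.summable_iff.2 hS)]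
  refine tsum_congr fun x => ?_
  unfold aconv
  rw [Complex.ofReal_tsum, ← tsum_mul_right]
  refine tsum_congr fun y => ?_
  have : e x d = e y d * e (x - y) d := by rw [← H.add]; simp
  simp only [E, Equiv.coe_fn_mk, this]
  push_cast
  ring

theorem delta_summable : Summable (fun x : G => if x = 0 then (1:ℝ) else 0) :=
  (hasSum_ite_eq (0:G) (1:ℝ)).summable

theorem ft_delta (H : CharSys G D P e) (d : D) :
    ft e (fun x : G => if x = 0 then (1:ℝ) else 0) d = 1 := by
  unfold ft
  rw [tsum_eq_single 0]
  · simp [H.zero]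
  · intro x hx
    simp [hx]

theorem ft_lin (H : CharSys G D P e) {f g : G → ℝ} (hf : Summable f) (hg : Summable g)
    (a b : ℝ) (d : D) :
    ft e (fun x => a * f x + b * g x) d = a * ft e f d + b * ft e g d := by
  unfold ft
  rw [← tsum_mul_left, ← tsum_mul_left,
    ← ((ft_summable H hf d).mul_left _).tsum_add ((ft_summable H hg d).mul_left _)]
  refine tsum_congr fun x => ?_
  push_cast
  ring

theorem ft_sum (H : CharSys G D P e) {n : ℕ} {f : Fin n → G → ℝ} (hf : ∀ j, Summable (f j))
    (d : D) :
    ft e (fun x => ∑ j, f j x) d = ∑ j, ft e (f j) d := by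
  unfold ft
  rw [← Summable.tsum_finsetSum (fun j _ => ft_summable H (hf j) d)]
  refine tsum_congr fun x => ?_
  push_cast
  rw [Finset.sum_mul]

theorem list_summable (l : List (G → ℝ)) (hl : ∀ f ∈ l, Summable f) : Summable (aconvList l) := by
  induction l with
  | nil => exact delta_summable
  | cons f l ih =>
    exact aconv_summable (hl f (by simp)) (ih fun g hg => hl g (by simp [hg]))

theorem ft_list (H : CharSys G D P e) (l : List (G → ℝ)) (hl : ∀ f ∈ l, Summable f) (d : D) :
    ft e (aconvList l) d = (l.map (fun f => ft e f d)).prod := by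
  induction l with
  | nil => rw [List.map_nil, List.prod_nil]; exact ft_delta H d
  | cons f l ih =>
    have hl' : ∀ g ∈ l, Summable g := fun g hg => hl g (by simp [hg])
    rw [List.map_cons, List.prod_cons, ← ih hl']
    exact ft_conv H (hl f (by simp)) (list_summable l hl') d

theorem ft_inv (H : CharSys G D P e) {f : G → ℝ} (hf : Summable f) (x : G) :
    (f x : ℂ) = ∫ d, ft e f d * e (-x) d ∂P := by
  have hc : Countable (Function.support f) := hf.countable_support
  have h1 : ∀ d, ft e f d * e (-x) d = ∑' y : Function.support f, (f y : ℂ) * e (y - x) d := by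
    intro d
    unfold ft
    rw [← tsum_mul_right]
    rw [tsum_subtype_eq_of_support_subset (f := fun y : G => (f y : ℂ) * e (y - x) d)]
    · refine tsum_congr fun y => ?_
      rw [sub_eq_add_neg, H.add]; ring
    · intro y hy hy'
      apply hy
      simp [hy']
  simp_rw [h1]
  rw [← integral_tsum_of_summable_integral_norm]
  · simp_rw [integral_const_mul, H.int]
    rw [tsum_subtype_eq_of_support_subset
      (f := fun y : G => (f y : ℂ) * (if y - x = 0 then 1 else 0))]
    · rw [tsum_eq_single x]
      · simp
      · intro y hy
        simp [sub_eq_zero, hy]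
    · intro y hy hy'
      apply hy
      simp [hy']
  · intro y
    exact (((H.cont _).const_smul (f y : ℂ)).integrable_of_hasCompactSupport
      (HasCompactSupport.of_compactSpace _))
  · simp only [norm_mul, H.nrm, mul_one, integral_const, Complex.norm_real]
    have h : Summable (fun y : Function.support f => |f y|) :=
      hf.abs.comp_injective Subtype.val_injective
    simpa using h

end

theorem ineq1 {n : ℕ} (hn : 1 ≤ n) (r : Fin n → ℝ) :
    ∏ j, |r j| ≤ (1 / 2 + 1 / (2 * (n:ℝ)) * ∑ j, r j * r j) ^ n := by
  have hn0 : (n:ℝ) ≠ 0 := by positivity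
  have h := Real.geom_mean_le_arith_mean_weighted Finset.univ (fun _ : Fin n => 1 / (n:ℝ))
    (fun j => |r j|) (fun _ _ => by positivity) (by simp [hn0]) (fun _ _ => abs_nonneg _)
  rw [Real.finsetProd_rpow _ _ (fun _ _ => abs_nonneg _)] at h
  have hP : 0 ≤ ∏ j, |r j| := Finset.prod_nonneg fun _ _ => abs_nonneg _
  have h2 : ∏ j, |r j| = ((∏ j, |r j|) ^ (1 / (n:ℝ))) ^ n := by
    rw [one_div, Real.rpow_inv_natCast_pow hP (by omega)]
  rw [h2]
  refine pow_le_pow_left₀ (Real.rpow_nonneg hP _) (h.trans ?_) n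
  have h3 : (1:ℝ) / 2 = ∑ j : Fin n, 1 / (2 * (n:ℝ)) := by
    simp; field_simp
  rw [h3, Finset.mul_sum, ← Finset.sum_add_distrib]
  refine Finset.sum_le_sum fun j _ => ?_
  have h4 : 1 / (2 * (n:ℝ)) + 1 / (2 * (n:ℝ)) * (r j * r j) - 1 / (n:ℝ) * |r j|
    = 1 / (2 * (n:ℝ)) * (1 - |r j|) ^ 2 := by
    rw [sub_sq, sq_abs]; field_simp; ring
  have : 0 ≤ 1 / (2 * (n:ℝ)) * (1 - |r j|) ^ 2 := by positivity
  linarith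

theorem ineq2 {n : ℕ} (hn : 1 ≤ n) (r : Fin n → ℝ) (hr : ∀ j, |r j| ≤ 1) :
    (1 / 2 + 1 / (2 * (n:ℝ)) * ∑ j, r j * r j) ^ n ≤
      ∏ j, (Real.exp (-(1 / 2)) + (1 - Real.exp (-(1 / 2))) * (r j * r j)) := by
  have hn0 : (n:ℝ) ≠ 0 := by positivity
  have h0 : 0 ≤ ∑ j, r j * r j := Finset.sum_nonneg fun j _ => mul_self_nonneg _
  have h1 : (1 / 2 + 1 / (2 * (n:ℝ)) * ∑ j, r j * r j) ≤
      Real.exp ((1 / 2 + 1 / (2 * (n:ℝ)) * ∑ j, r j * r j) - 1) := by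
    have := Real.add_one_le_exp ((1 / 2 + 1 / (2 * (n:ℝ)) * ∑ j, r j * r j) - 1)
    linarith
  refine (pow_le_pow_left₀ (by positivity) h1 n).trans ?_
  rw [← Real.exp_nat_mul]
  have h2 : (n:ℝ) * ((1 / 2 + 1 / (2 * (n:ℝ)) * ∑ j, r j * r j) - 1)
      = ∑ j, (-(1 / 2) * (1 - r j * r j)) := by
    rw [← Finset.mul_sum, Finset.sum_sub_distrib]
    simp
    field_simp
    ring
  rw [h2, Real.exp_sum]
  refine Finset.prod_le_prod (fun _ _ => (Real.exp_pos _).le) fun j _ => ?_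
  have ht : r j * r j ≤ 1 := by
    have := (sq_le_one_iff_abs_le_one (r j)).2 (hr j)
    nlinarith
  have := convexOn_exp.2 (Set.mem_univ (-(1/2:ℝ))) (Set.mem_univ (0:ℝ))
    (sub_nonneg.2 ht) (mul_self_nonneg (r j)) (by ring)
  simp only [smul_eq_mul, mul_zero, add_zero, Real.exp_zero, mul_one] at this
  rw [mul_comm (-(1/2:ℝ))]
  linarith

/-- **Proposition 6.1** of Tao, "Inverse theorems for sets and measures of polynomial growth":
for symmetric probability measures `μ₁,…,μₙ` on an abelian group and
`μ := ½δ₀ + (1/2n)(μ₁*μ₁ + ⋯ + μₙ*μₙ)`, one has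
`sup_x (μ₁*⋯*μₙ)(x) ≤ μ^{*n}(0) ≤ (μ̃₁*⋯*μ̃ₙ)(0)` where
`μ̃ⱼ := e^{-1/2}δ₀ + (1 − e^{-1/2}) μⱼ*μⱼ`. -/
theorem convolution_concentration_symmetrisation :
    ∀ (G : Type u) [AddCommGroup G] [DecidableEq G] (n : ℕ) (μs : Fin n → G → ℝ)
      (μ : G → ℝ),
      1 ≤ n →
      (∀ j x, 0 ≤ μs j x) → (∀ j, (∑' x, μs j x) = 1) → (∀ j x, μs j (-x) = μs j x) →
      (∀ x : G, μ x = (1 / 2) * (if x = 0 then 1 else 0) +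
        (1 / (2 * (n : ℝ))) * ∑ j, aconv (μs j) (μs j) x) →
      (∀ x : G, aconvList (List.ofFn μs) x ≤ aconvList (List.replicate n μ) 0) ∧
      aconvList (List.replicate n μ) 0 ≤
        aconvList (List.ofFn fun j => fun x : G =>
          Real.exp (-(1 / 2)) * (if x = 0 then 1 else 0) +
            (1 - Real.exp (-(1 / 2))) * aconv (μs j) (μs j) x) 0 := by
  intro G _ _ n μs μ hn hpos hsum hsym hμ
  have hS : ∀ j, Summable (μs j) := by
    intro j
    by_contra h
    have := hsum j
    rw [tsum_eq_zero_of_not_summable h] at this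
    exact zero_ne_one this
  obtain ⟨D, _, _, _, _, P, _, e, H⟩ := exists_charSys G
  have hS2 : ∀ j, Summable (aconv (μs j) (μs j)) := fun j => aconv_summable (hS j) (hS j)
  let r : Fin n → D → ℝ := fun j d => (ft e (μs j) d).re
  have hr : ∀ j d, ft e (μs j) d = (r j d : ℂ) := fun j d => (ft_real H (hsym j) d).symm
  have hrc : ∀ j, Continuous (r j) := fun j => Complex.continuous_re.comp (ft_cont H (hS j))
  have hr1 : ∀ j d, |r j d| ≤ 1 := fun j d =>
    (Complex.abs_re_le_norm _).trans (ft_norm H (hS j) (hpos j) (hsum j) d)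
  have hr2 : ∀ j d, ft e (aconv (μs j) (μs j)) d = ((r j d * r j d : ℝ) : ℂ) := by
    intro j d
    rw [ft_conv H (hS j) (hS j), hr]; push_cast; rfl
  have hμ' : μ = fun x => (1 / 2) * (if x = 0 then 1 else 0) +
        (1 / (2 * (n : ℝ))) * ∑ j, aconv (μs j) (μs j) x := funext hμ
  have hSs : Summable (fun x => ∑ j, aconv (μs j) (μs j) x) := summable_sum fun j _ => hS2 j
  have hSμ : Summable μ := by
    rw [hμ']
    exact (delta_summable.mul_left _).add (hSs.mul_left _)
  have hfμ : ∀ d, ft e μ d = ((1 / 2 + 1 / (2 * (n:ℝ)) * ∑ j, r j d * r j d : ℝ) : ℂ) := by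
    intro d
    rw [hμ', ft_lin H delta_summable hSs, ft_delta H, ft_sum H hS2]
    simp_rw [hr2]
    push_cast
    ring
  let ν : Fin n → G → ℝ := fun j => fun x : G =>
          Real.exp (-(1 / 2)) * (if x = 0 then 1 else 0) +
            (1 - Real.exp (-(1 / 2))) * aconv (μs j) (μs j) x
  have hSν : ∀ j, Summable (ν j) := fun j =>
    (delta_summable.mul_left _).add ((hS2 j).mul_left _)
  have hfν : ∀ j d, ft e (ν j) d =
      ((Real.exp (-(1 / 2)) + (1 - Real.exp (-(1 / 2))) * (r j d * r j d) : ℝ) : ℂ) := by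
    intro j d
    simp only [ν]
    rw [ft_lin H delta_summable (hS2 j), ft_delta H, hr2]
    push_cast
    ring
  -- the three lists
  have hl1 : ∀ f ∈ List.ofFn μs, Summable f := by
    intro f hf
    obtain ⟨j, rfl⟩ := (List.mem_ofFn' _ _).1 hf
    exact hS j
  have hl2 : ∀ f ∈ List.replicate n μ, Summable f := by
    intro f hf
    rw [List.eq_of_mem_replicate hf]
    exact hSμ
  have hl3 : ∀ f ∈ List.ofFn ν, Summable f := by
    intro f hf
    obtain ⟨j, rfl⟩ := (List.mem_ofFn' _ _).1 hf
    exact hSν j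
  let A : D → ℝ := fun d => ∏ j, r j d
  let B : D → ℝ := fun d => (1 / 2 + 1 / (2 * (n:ℝ)) * ∑ j, r j d * r j d) ^ n
  let C : D → ℝ := fun d =>
    ∏ j, (Real.exp (-(1 / 2)) + (1 - Real.exp (-(1 / 2))) * (r j d * r j d))
  have hA : Continuous A := by fun_prop
  have hB : Continuous B := by fun_prop
  have hC : Continuous C := by fun_prop
  have hint : ∀ F : D → ℝ, Continuous F → MeasureTheory.Integrable F P := fun F hF =>
    hF.integrable_of_hasCompactSupport (HasCompactSupport.of_compactSpace _)
  have e1 : ∀ d, ft e (aconvList (List.ofFn μs)) d = (A d : ℂ) := by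
    intro d
    rw [ft_list H _ hl1, List.map_ofFn, List.prod_ofFn]
    simp [A, hr]
  have e2 : ∀ d, ft e (aconvList (List.replicate n μ)) d = (B d : ℂ) := by
    intro d
    rw [ft_list H _ hl2, List.map_replicate, List.prod_replicate, hfμ]
    simp only [B]
    push_cast
    rfl
  have e3 : ∀ d, ft e (aconvList (List.ofFn ν)) d = (C d : ℂ) := by
    intro d
    rw [ft_list H _ hl3, List.map_ofFn, List.prod_ofFn]
    simp only [C, Function.comp_apply, hfν, Complex.ofReal_prod]
  have v2 : aconvList (List.replicate n μ) 0 = ∫ d, B d ∂P := by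
    have := ft_inv H (list_summable _ hl2) 0
    simp_rw [e2, neg_zero, H.zero, mul_one] at this
    rw [integral_complex_ofReal] at this
    exact_mod_cast this
  have v3 : aconvList (List.ofFn ν) 0 = ∫ d, C d ∂P := by
    have := ft_inv H (list_summable _ hl3) 0
    simp_rw [e3, neg_zero, H.zero, mul_one] at this
    rw [integral_complex_ofReal] at this
    exact_mod_cast this
  constructor
  · intro x
    rw [v2]
    have := ft_inv H (list_summable _ hl1) x
    simp_rw [e1] at this
    have h1 : |aconvList (List.ofFn μs) x| ≤ ∫ d, B d ∂P := by
      rw [← Real.norm_eq_abs, ← Complex.norm_real, this]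
      refine MeasureTheory.norm_integral_le_of_norm_le (hint B hB) (.of_forall fun d => ?_)
      rw [norm_mul, H.nrm, mul_one, Complex.norm_real, Real.norm_eq_abs]
      simp only [A, Finset.abs_prod]
      exact ineq1 hn _
    exact (le_abs_self _).trans h1
  · change _ ≤ aconvList (List.ofFn ν) 0
    rw [v2, v3]
    exact MeasureTheory.integral_mono (hint B hB) (hint C hC)
      fun d => ineq2 hn _ (fun j => hr1 j d)
end

section
/- For every natural number d ≥ 1 there exists a constant C_d, depending only on d, with the following property. Let P = (p_{ij})_{1≤i,j≤d} be a symmetric stochastic d×d real matrix (i.e., p_{ij} ≥ 0, p_{ij} = p_{ji}, and ∑_{j=1}^d p_{ij} = 1 for all i), let δ > 0, and let (a_{ij})_{1≤i,j≤d} be a real antisymmetric matrix (a_{ij} = −a_{ji}) such that |a_{ij}| ≤ 1 and a_{ij}²·p_{ij} ≤ δ² for all i,j. Then there exist reals t_1,…,t_d with |t_i| ≤ C_d for all i, such that ∑_{j=1}^d a_{ij}p_{ij} = t_i − ∑_{j=1}^d p_{ij}t_j for all i = 1,…,d, and p_{ij}·(t_i − t_j)² ≤ C_d²·δ² for all i,j.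 -/
open MeasureTheory in
theorem gcl_weak {d : ℕ} (p a : Fin d → Fin d → ℝ) (hp : ∀ i j, 0 ≤ p i j) :
    ∃ u : Fin d → ℝ, ∀ s : Fin d → ℝ,
      ∑ i, ∑ j, p i j * (a i j - (u i - u j)) * (s i - s j) = 0 := by
  let G : (Fin d → ℝ) →ₗ[ℝ] EuclideanSpace ℝ (Fin d × Fin d) :=
    { toFun := fun s => WithLp.toLp 2 (fun q => Real.sqrt (p q.1 q.2) * (s q.1 - s q.2))
      map_add' := by
        intro x y; ext q; simp; ring
      map_smul' := by
        intro c x; ext q; simp; ring }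
  let v : EuclideanSpace ℝ (Fin d × Fin d) :=
    WithLp.toLp 2 (fun q => Real.sqrt (p q.1 q.2) * a q.1 q.2)
  obtain ⟨y, ⟨u, hu⟩, z, hz, hv⟩ := Submodule.exists_add_mem_mem_orthogonal (K := LinearMap.range G) v
  refine ⟨u, fun s => ?_⟩
  have h := (Submodule.mem_orthogonal _ _).1 hz (G s) ⟨s, rfl⟩
  have hz' : z = v - G u := by rw [hv, hu]; simp
  rw [hz', PiLp.inner_apply, Fintype.sum_prod_type] at h
  rw [← h]
  refine Finset.sum_congr rfl fun i _ => Finset.sum_congr rfl fun j _ => ?_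
  have := Real.mul_self_sqrt (hp i j)
  simp [G, v]
  linear_combination (-(a i j - (u i - u j)) * (s i - s j)) * this

theorem gcl_cut {d : ℕ} (p a : Fin d → Fin d → ℝ) (hp : ∀ i j, 0 ≤ p i j)
    (ha : ∀ i j, |a i j| ≤ 1) (u : Fin d → ℝ)
    (hu : ∀ s : Fin d → ℝ, ∑ i, ∑ j, p i j * (a i j - (u i - u j)) * (s i - s j) = 0)
    (i j : Fin d) (hij : 0 < p i j) (x : ℝ) (hj : u j ≤ x) (hi : x < u i) :
    ∃ k, u k ≤ x ∧ x ≤ u k + 1 := by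
  by_contra! hcon
  have h := hu (fun k => if x < u k then 1 else 0)
  have hle : ∀ k l, p k l * (a k l - (u k - u l)) *
      ((if x < u k then (1:ℝ) else 0) - (if x < u l then 1 else 0)) ≤ 0 := by
    intro k l
    have h1 := abs_le.1 (ha k l)
    rw [mul_assoc]
    apply mul_nonpos_of_nonneg_of_nonpos (hp k l)
    by_cases hk : x < u k <;> by_cases hl : x < u l <;> simp only [hk, hl, if_true, if_false]
    · simp
    · have := hcon l (not_lt.1 hl)
      linarith
    · have := hcon k (not_lt.1 hk)
      linarith
    · simp
  have h2 := (Finset.sum_eq_zero_iff_of_nonpos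
    (fun k _ => Finset.sum_nonpos fun l _ => hle k l)).1 h i (Finset.mem_univ _)
  have h3 := (Finset.sum_eq_zero_iff_of_nonpos (fun l _ => hle i l)).1 h2 j (Finset.mem_univ _)
  simp only [hi, not_lt.2 hj, if_true, if_false] at h3
  have h1 := abs_le.1 (ha i j)
  have := hcon j hj
  nlinarith

open MeasureTheory in
theorem gcl_compress {d : ℕ} (u : Fin d → ℝ) :
    ∃ t : Fin d → ℝ, (∀ i, |t i| ≤ d) ∧
      ∀ i j, u j ≤ u i → (∀ x, u j ≤ x → x < u i → ∃ k, u k ≤ x ∧ x ≤ u k + 1) →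
        t i - t j = u i - u j := by
  let A : Set ℝ := ⋃ k, Set.Icc (u k) (u k + 1)
  have hAm : MeasurableSet A := MeasurableSet.iUnion fun k => measurableSet_Icc
  have hAv : volume A ≤ d := by
    refine (measure_iUnion_fintype_le _ _).trans ?_
    simp
  have hAf : volume A ≠ ⊤ := ne_top_of_le_ne_top (by simp) hAv
  have hf : ∀ s : Set ℝ, volume (s ∩ A) ≠ ⊤ := fun s =>
    ne_top_of_le_ne_top hAf (measure_mono Set.inter_subset_right)
  refine ⟨fun i => volume.real (Set.Iio (u i) ∩ A), fun i => ?_, fun i j hij hx => ?_⟩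
  · rw [abs_of_nonneg measureReal_nonneg]
    refine ENNReal.toReal_le_of_le_ofReal (by simp) ?_
    refine (measure_mono Set.inter_subset_right).trans (hAv.trans ?_)
    simp
  · have hsub : Set.Ico (u j) (u i) ⊆ A := fun x hx' => by
      obtain ⟨k, h1, h2⟩ := hx x hx'.1 hx'.2
      exact Set.mem_iUnion.2 ⟨k, h1, h2⟩
    have he : Set.Iio (u i) ∩ A = (Set.Iio (u j) ∩ A) ∪ Set.Ico (u j) (u i) := by
      rw [← Set.Iio_union_Ico_eq_Iio hij, Set.union_inter_distrib_right,
        Set.inter_eq_left.2 hsub]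
    have hd : Disjoint (Set.Iio (u j) ∩ A) (Set.Ico (u j) (u i)) := by
      rw [Set.disjoint_left]
      intro x h1 h2
      exact absurd h2.1 (not_le.2 h1.1)
    simp only
    rw [he, measureReal_union hd measurableSet_Ico (hf _) (by simp)]
    simp [hij]

/-- **Lemma 5.1** of Tao, "Inverse theorems for sets and measures of polynomial growth":
given a symmetric stochastic matrix `(p_{ij})` and an antisymmetric matrix `(a_{ij})` with
`|a_{ij}| ≤ 1` and `a_{ij}² p_{ij} ≤ δ²`, there exist bounded reals `t₁,…,t_d` solving the
drift equation `∑_j a_{ij}p_{ij} = t_i − ∑_j p_{ij}t_j` with `p_{ij}(t_i − t_j)² ≤ C_d² δ²`. -/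
theorem gauge_change_lemma :
    ∀ d : ℕ, 1 ≤ d →
    ∃ C : ℝ, ∀ (p a : Fin d → Fin d → ℝ) (δ : ℝ),
      0 < δ →
      (∀ i j, 0 ≤ p i j) → (∀ i j, p i j = p j i) → (∀ i, ∑ j, p i j = 1) →
      (∀ i j, a i j = -a j i) → (∀ i j, |a i j| ≤ 1) → (∀ i j, a i j ^ 2 * p i j ≤ δ ^ 2) →
      ∃ t : Fin d → ℝ,
        (∀ i, |t i| ≤ C) ∧
        (∀ i, ∑ j, a i j * p i j = t i - ∑ j, p i j * t j) ∧
        (∀ i j, p i j * (t i - t j) ^ 2 ≤ C ^ 2 * δ ^ 2) := by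
  intro d _
  refine ⟨d, fun p a δ _ hp hs h1 has ha had => ?_⟩
  obtain ⟨u, hu⟩ := gcl_weak p a hp
  obtain ⟨t, htb, ht⟩ := gcl_compress u
  have key : ∀ i j, 0 < p i j → t i - t j = u i - u j := by
    intro i j hij
    rcases le_total (u j) (u i) with h | h
    · exact ht i j h fun x => gcl_cut p a hp ha u hu i j hij x
    · have := ht j i h fun x => gcl_cut p a hp ha u hu j i (hs i j ▸ hij) x
      linarith
  have key' : ∀ i j, p i j * (t i - t j) = p i j * (u i - u j) := by
    intro i j
    rcases (hp i j).eq_or_lt with h | h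
    · simp [← h]
    · rw [key i j h]
  have hw : ∀ s : Fin d → ℝ, ∑ i, ∑ j, p i j * (a i j - (t i - t j)) * (s i - s j) = 0 := by
    intro s
    rw [← hu s]
    refine Finset.sum_congr rfl fun i _ => Finset.sum_congr rfl fun j _ => ?_
    linear_combination (-(s i - s j)) * key' i j
  refine ⟨t, htb, fun k => ?_, fun i j => ?_⟩
  · have hk := hw (fun i => if i = k then 1 else 0)
    have e1 : ∑ i, ∑ j, p i j * (a i j - (t i - t j)) *
        ((if i = k then (1:ℝ) else 0) - (if j = k then 1 else 0)) =
        ∑ j, p k j * (a k j - (t k - t j)) - ∑ i, p i k * (a i k - (t i - t k)) := by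
      simp only [mul_sub _ (ite _ _ _) _, Finset.sum_sub_distrib]
      congr 1
      · rw [Finset.sum_comm]; simp
      · simp
    have e2 : ∑ i, p i k * (a i k - (t i - t k)) = -∑ j, p k j * (a k j - (t k - t j)) := by
      rw [← Finset.sum_neg_distrib]
      refine Finset.sum_congr rfl fun i _ => ?_
      rw [hs i k, has i k]; ring
    have e3 : ∑ j, p k j * (a k j - (t k - t j)) =
        ∑ j, a k j * p k j - (∑ j, p k j) * t k + ∑ j, p k j * t j := by
      rw [Finset.sum_mul, ← Finset.sum_sub_distrib, ← Finset.sum_add_distrib]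
      refine Finset.sum_congr rfl fun i _ => ?_
      ring
    rw [h1 k] at e3
    linarith
  · have hE := hw t
    have h2 : ∑ i, ∑ j, p i j * (t i - t j) ^ 2 ≤ ∑ i, ∑ j, a i j ^ 2 * p i j := by
      have h3 : ∑ i, ∑ j, p i j * (t i - t j) ^ 2
          + 2 * ∑ i, ∑ j, p i j * (a i j - (t i - t j)) * (t i - t j)
          ≤ ∑ i, ∑ j, a i j ^ 2 * p i j := by
        simp only [Finset.mul_sum, ← Finset.sum_add_distrib]
        refine Finset.sum_le_sum fun i _ => Finset.sum_le_sum fun j _ => ?_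
        nlinarith [mul_nonneg (hp i j) (sq_nonneg (a i j - (t i - t j)))]
      linarith
    have h4 : ∑ i, ∑ j, a i j ^ 2 * p i j ≤ (d:ℝ) ^ 2 * δ ^ 2 := by
      refine (Finset.sum_le_sum fun i _ => Finset.sum_le_sum fun j _ => had i j).trans ?_
      simp only [Finset.sum_const, Finset.card_univ, Fintype.card_fin, nsmul_eq_mul]
      apply le_of_eq; ring
    have hnn : ∀ i j, 0 ≤ p i j * (t i - t j) ^ 2 := fun i j => mul_nonneg (hp i j) (sq_nonneg _)
    have h5 : p i j * (t i - t j) ^ 2 ≤ ∑ j, p i j * (t i - t j) ^ 2 :=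
      Finset.single_le_sum (f := fun j => p i j * (t i - t j) ^ 2)
        (fun l _ => hnn i l) (Finset.mem_univ j)
    have h6 : ∑ j, p i j * (t i - t j) ^ 2 ≤ ∑ i, ∑ j, p i j * (t i - t j) ^ 2 :=
      Finset.single_le_sum (f := fun i => ∑ j, p i j * (t i - t j) ^ 2)
        (fun l _ => Finset.sum_nonneg fun m _ => hnn l m) (Finset.mem_univ i)
    linarith
end

section
/- For every natural number d ≥ 1 there exists a constant C_d, depending only on d, with the following property. Let P = (p_{ij})_{1≤i,j≤d} be a symmetric stochastic d×d real matrix, let λ be a real number, and let u = (u_1,…,u_d) ∈ ℝ^d be a vector with Euclidean norm ‖u‖₂ = 1 satisfying Pu = λu. Then p_{ij}·|u_i − u_j| ≤ C_d·(1 − λ) for all 1 ≤ i,j ≤ d. -/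
theorem aux_key (d : ℕ) (p : Fin d → Fin d → ℝ) (lam : ℝ) (u : Fin d → ℝ)
    (h0 : ∀ i j, 0 ≤ p i j) (hs : ∀ i j, p i j = p j i) (h1 : ∀ i, ∑ j, p i j = 1)
    (hu : (∑ i, u i ^ 2) = 1) (he : ∀ i, ∑ j, p i j * u j = lam * u i) :
    0 ≤ 1 - lam ∧ ∀ i j, u j < u i → p i j * (u i - u j) ≤ d * (1 - lam) := by
  have hrow : ∀ k, ∑ l, p k l * (u k - u l) = (1 - lam) * u k := by
    intro k
    simp only [mul_sub, Finset.sum_sub_distrib, ← Finset.sum_mul, h1, he]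
    ring
  have hpos : 0 ≤ 1 - lam := by
    have hX : ∑ k, ∑ l, u k * (p k l * (u k - u l)) = 1 - lam := by
      simp only [← Finset.mul_sum, hrow]
      calc ∑ k, u k * ((1 - lam) * u k) = (1 - lam) * ∑ k, u k ^ 2 := by
            rw [Finset.mul_sum]; exact Finset.sum_congr rfl fun k _ => by ring
        _ = 1 - lam := by rw [hu, mul_one]
    have hX2 := hX
    rw [Finset.sum_comm] at hX2
    have h2 : 0 ≤ ∑ k, ∑ l, p k l * (u k - u l) ^ 2 :=
      Finset.sum_nonneg fun k _ => Finset.sum_nonneg fun l _ => mul_nonneg (h0 k l) (sq_nonneg _)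
    have h3 : ∑ k, ∑ l, p k l * (u k - u l) ^ 2 = (1 - lam) + (1 - lam) := by
      conv_rhs => rw [← hX]
      nth_rewrite 2 [hX]
      rw [← hX2, ← Finset.sum_add_distrib]
      refine Finset.sum_congr rfl fun k _ => ?_
      rw [← Finset.sum_add_distrib]
      refine Finset.sum_congr rfl fun l _ => ?_
      rw [hs l k]; ring
    linarith
  refine ⟨hpos, fun i j hij => ?_⟩
  have hle : ∀ k, u k ≤ 1 := fun k => by
    have := Finset.single_le_sum (f := fun i => u i ^ 2) (fun i _ => sq_nonneg (u i))
      (Finset.mem_univ k)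
    simp only [hu] at this
    nlinarith
  set S : Finset (Fin d) := Finset.univ.filter fun k => u i ≤ u k with hS
  have hanti : ∑ k ∈ S, ∑ l ∈ S, p k l * (u k - u l) = 0 := by
    have h : ∑ k ∈ S, ∑ l ∈ S, p k l * (u k - u l)
        = -∑ k ∈ S, ∑ l ∈ S, p k l * (u k - u l) := by
      conv_lhs => rw [Finset.sum_comm]
      simp only [← Finset.sum_neg_distrib]
      refine Finset.sum_congr rfl fun k _ => Finset.sum_congr rfl fun l _ => ?_
      rw [hs l k]; ring
    linarith
  have hcut : ∑ k ∈ S, ∑ l ∈ Sᶜ, p k l * (u k - u l) = ∑ k ∈ S, (1 - lam) * u k := by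
    have : ∑ k ∈ S, (1 - lam) * u k = ∑ k ∈ S, ∑ l ∈ S, p k l * (u k - u l)
        + ∑ k ∈ S, ∑ l ∈ Sᶜ, p k l * (u k - u l) := by
      rw [← Finset.sum_add_distrib]
      exact Finset.sum_congr rfl fun k _ => by rw [Finset.sum_add_sum_compl, hrow]
    linarith
  have hnn : ∀ k ∈ S, ∀ l ∈ Sᶜ, 0 ≤ p k l * (u k - u l) := by
    intro k hk l hl
    simp [hS] at hk hl
    exact mul_nonneg (h0 k l) (by linarith)
  have hiS : i ∈ S := by simp [hS]
  have hjS : j ∈ Sᶜ := by simp [hS, hij]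
  calc p i j * (u i - u j) ≤ ∑ l ∈ Sᶜ, p i l * (u i - u l) :=
        Finset.single_le_sum (f := fun l => p i l * (u i - u l)) (hnn i hiS) hjS
    _ ≤ ∑ k ∈ S, ∑ l ∈ Sᶜ, p k l * (u k - u l) :=
        Finset.single_le_sum (f := fun k => ∑ l ∈ Sᶜ, p k l * (u k - u l))
          (fun k hk => Finset.sum_nonneg (hnn k hk)) hiS
    _ = ∑ k ∈ S, (1 - lam) * u k := hcut
    _ ≤ ∑ k ∈ S, (1 - lam) :=
        Finset.sum_le_sum fun k _ => mul_le_of_le_one_right hpos (hle k)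
    _ ≤ ∑ k : Fin d, (1 - lam) :=
        Finset.sum_le_sum_of_subset_of_nonneg (Finset.subset_univ _) fun _ _ _ => hpos
    _ = d * (1 - lam) := by simp; ring

/-- The eigenvector estimate from the proof of Lemma 5.1 of Tao, "Inverse theorems for sets
and measures of polynomial growth": if `u` is a unit eigenvector of a symmetric stochastic
matrix `(p_{ij})` with eigenvalue `λ`, then `p_{ij}|u_i − u_j| ≤ C_d (1 − λ)` for all `i,j`. -/
theorem stochastic_eigenvector_estimate :
    ∀ d : ℕ, 1 ≤ d →
    ∃ C : ℝ, ∀ (p : Fin d → Fin d → ℝ) (lam : ℝ) (u : Fin d → ℝ),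
      (∀ i j, 0 ≤ p i j) → (∀ i j, p i j = p j i) → (∀ i, ∑ j, p i j = 1) →
      (∑ i, u i ^ 2) = 1 →
      (∀ i, ∑ j, p i j * u j = lam * u i) →
      ∀ i j, p i j * |u i - u j| ≤ C * (1 - lam) := by
  intro d _
  refine ⟨d, fun p lam u h0 hs h1 hu he i j => ?_⟩
  obtain ⟨hpos, key⟩ := aux_key d p lam u h0 hs h1 hu he
  rcases lt_trichotomy (u i) (u j) with h | h | h
  · rw [abs_sub_comm, abs_of_pos (sub_pos.2 h), hs i j]
    exact key j i h
  · rw [h, sub_self, abs_zero, mul_zero]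
    positivity
  · rw [abs_of_pos (sub_pos.2 h)]
    exact key i j h
end

section
/- Let G be an abelian group (written additively), let w_1,…,w_r ∈ G and let N_1,…,N_r > 0 be reals such that the sums n_1w_1 + ⋯ + n_rw_r with integers |n_i| ≤ 2N_i for all i are pairwise distinct (2-properness). Let P' := {n_1w_1 + ⋯ + n_rw_r : n_i ∈ ℤ, |n_i| ≤ N_i for all i}, let m ≥ 1 be a natural number, and let v ∈ G be such that j·v ∈ P' for every j = 1,…,m. Then there exist integers a_1,…,a_r with |a_i| ≤ N_i/m for all i and v = a_1w_1 + ⋯ + a_rw_r. -/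
universe u

/-- The division-in-a-proper-progression lemma from Section 6 of Tao, "Inverse theorems for
sets and measures of polynomial growth": if `P'` is a `2`-proper generalised arithmetic
progression with side lengths `N₁,…,N_r` and `j·v ∈ P'` for all `j = 1,…,m`, then `v` lies in
the shrunk progression with side lengths `Nᵢ/m`. -/
theorem proper_progression_division :
    ∀ (G : Type u) [AddCommGroup G] (r : ℕ) (w : Fin r → G) (N : Fin r → ℝ),
      (∀ i, 0 < N i) →
      -- 2-properness
      (∀ n n' : Fin r → ℤ, (∀ i, |(n i : ℝ)| ≤ 2 * N i) → (∀ i, |(n' i : ℝ)| ≤ 2 * N i) →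
        (∑ i, n i • w i) = (∑ i, n' i • w i) → n = n') →
      ∀ (m : ℕ) (v : G), 1 ≤ m →
      (∀ j : ℕ, 1 ≤ j → j ≤ m →
        ∃ nn : Fin r → ℤ, (∀ i, |(nn i : ℝ)| ≤ N i) ∧ (j : ℤ) • v = ∑ i, nn i • w i) →
      ∃ a : Fin r → ℤ, (∀ i, |(a i : ℝ)| ≤ N i / (m : ℝ)) ∧ v = ∑ i, a i • w i := by
  intro G _ r w N hN hP m v hm h
  obtain ⟨a, ha, hv⟩ := h 1 le_rfl hm
  have hv' : v = ∑ i, a i • w i := by simpa using hv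
  have key : ∀ j : ℕ, 1 ≤ j → j ≤ m → ∀ i, |(j : ℝ) * (a i : ℝ)| ≤ N i := by
    intro j hj
    induction j, hj using Nat.le_induction with
    | base =>
      intro _ i
      simpa using ha i
    | succ j hj ih =>
      intro hjm
      have ih' := ih (by omega)
      obtain ⟨nn, hnn, he⟩ := h (j + 1) (by omega) hjm
      have heq : nn = fun i => ((j + 1 : ℕ) : ℤ) * a i := by
        apply hP
        · intro i
          linarith [hnn i, hN i]
        · intro i
          have h1 := ih' i
          have h2 := ha i
          have h3 := abs_add_le ((j : ℝ) * (a i : ℝ)) (a i : ℝ)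
          have h4 : (((((j + 1 : ℕ) : ℤ) * a i : ℤ)) : ℝ) = (j : ℝ) * (a i : ℝ) + (a i : ℝ) := by
            push_cast
            ring
          rw [h4]
          linarith
        · rw [← he]
          conv_lhs => rw [hv']
          rw [Finset.smul_sum]
          exact Finset.sum_congr rfl fun i _ => (mul_smul _ _ _).symm
      intro i
      have h5 := hnn i
      rw [heq] at h5
      push_cast at h5 ⊢
      exact h5
  refine ⟨a, fun i => ?_, hv'⟩
  have hm0 : (0 : ℝ) < m := by exact_mod_cast hm
  have h6 := key m hm le_rfl i
  rw [abs_mul, abs_of_pos hm0] at h6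
  rw [le_div_iff₀ hm0]
  linarith
end

section
/- For every natural number m ≥ 1 there exists a constant C_m, depending only on m, with the following property. Let (M,d) be a pseudometric space and let x_1,…,x_m ∈ M. Let p : {2,…,m} → {1,…,m} be a function with p(i) < i and d(x_i, x_{p(i)}) = min_{1 ≤ j < i} d(x_i, x_j) for each i, and let T be the tree on vertex set {1,…,m} with edge set {{i, p(i)} : 2 ≤ i ≤ m}. Then for any vertices i and j, the sum of the lengths d(x_a, x_b) over the edges {a,b} traversed by the (unique) path in T from i to j satisfies d(x_i, x_j) ≤ (sum of edge lengths along the path) ≤ C_m·d(x_i, x_j). -/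
universe u

abbrev gT {m : ℕ} (p : Fin m → Fin m) : SimpleGraph (Fin m) :=
  SimpleGraph.fromRel fun a b : Fin m => a.val ≠ 0 ∧ p a = b

theorem asc_path {m : ℕ} (p : Fin m → Fin m) (hp : ∀ i : Fin m, i.val ≠ 0 → p i < i)
    {k j : Fin m} (q : (gT p).Walk k j) : q.IsPath → p k ∉ q.support → k ≤ j := by
  induction q with
  | nil => intros; exact le_rfl
  | @cons a b c h q ih =>
    intro hP hn
    rw [SimpleGraph.Walk.cons_isPath_iff] at hP
    rw [SimpleGraph.Walk.support_cons, List.mem_cons, not_or] at hn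
    rw [SimpleGraph.fromRel_adj] at h
    rcases h with ⟨_, ⟨_, h2⟩ | ⟨h1, h2⟩⟩
    · exact absurd (h2 ▸ q.start_mem_support) hn.2
    · have h3 := ih hP.1 (h2 ▸ hP.2)
      have h4 := hp b h1
      rw [h2] at h4
      exact h4.le.trans h3

theorem greedy_aux {m : ℕ} {M : Type u} [PseudoMetricSpace M] (x : Fin m → M) (p : Fin m → Fin m)
    (hp : ∀ i : Fin m, i.val ≠ 0 →
        p i < i ∧ ∀ j : Fin m, j < i → dist (x i) (x (p i)) ≤ dist (x i) (x j)) (n : ℕ) :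
    ∀ (i j : Fin m) (w : (gT p).Walk i j), w.IsPath → w.length = n →
      (w.darts.map fun dd => dist (x dd.toProd.1) (x dd.toProd.2)).sum ≤
        (2 ^ n - 1) * dist (x i) (x j) := by
  induction n with
  | zero =>
    intro i j w hw hl
    cases w with
    | nil => simp
    | cons h q => simp at hl
  | succ n ih =>
    have key : ∀ (i j : Fin m) (w : (gT p).Walk i j), w.IsPath → w.length = n + 1 → j < i →
      (w.darts.map fun dd => dist (x dd.toProd.1) (x dd.toProd.2)).sum ≤
        (2 ^ (n+1) - 1) * dist (x i) (x j) := by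
      intro i j w hw hl hji
      cases w with
      | nil => simp at hl
      | @cons _ k _ h q =>
        rw [SimpleGraph.Walk.cons_isPath_iff] at hw
        have hk : i.val ≠ 0 ∧ p i = k := by
          rw [SimpleGraph.fromRel_adj] at h
          rcases h with ⟨_, h | ⟨h1, h2⟩⟩
          · exact h
          · have h3 := asc_path p (fun i hi => (hp i hi).1) q hw.1 (h2 ▸ hw.2)
            have h4 := (hp k h1).1
            rw [h2] at h4
            exact absurd (h4.trans_le h3) (not_lt.2 hji.le)
        have h1 := ih k j q hw.1 (by simpa using hl)
        have h2 := (hp i hk.1).2 j hji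
        rw [hk.2] at h2
        have h3 := dist_triangle_left (x k) (x j) (x i)
        have h4 : (1:ℝ) ≤ 2 ^ n := one_le_pow₀ (by norm_num)
        simp only [SimpleGraph.Walk.darts_cons, List.map_cons, List.sum_cons]
        rw [pow_succ]
        nlinarith
    intro i j w hw hl
    rcases lt_trichotomy i j with h | h | h
    · have := key j i w.reverse hw.reverse (by simpa using hl) h
      rw [SimpleGraph.Walk.darts_reverse, List.map_reverse, List.sum_reverse, List.map_map,
        dist_comm] at this
      refine le_trans (le_of_eq ?_) this
      congr 2
      funext dd
      simp [dist_comm]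
    · subst h
      rw [SimpleGraph.Walk.isPath_iff_eq_nil] at hw
      subst hw
      simp
    · exact key i j w hw hl h

theorem walk_lower {V : Type*} {G : SimpleGraph V} {M : Type u} [PseudoMetricSpace M] (x : V → M)
    {i j : V} (w : G.Walk i j) :
    dist (x i) (x j) ≤ (w.darts.map fun dd => dist (x dd.toProd.1) (x dd.toProd.2)).sum := by
  induction w with
  | nil => simp
  | @cons a b c h q ih =>
    simp only [SimpleGraph.Walk.darts_cons, List.map_cons, List.sum_cons]
    exact (dist_triangle _ (x b) _).trans (by gcongr)



/-- **Greedy spanning tree lemma** (from the proof of Lemma 3.1 of Tao, "Inverse theorems for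
sets and measures of polynomial growth"): if points `x₁,…,x_m` in a pseudometric space are
joined into a spanning tree `T` by connecting each `x_i` (`i ≥ 2`) to a closest earlier point
`x_{p(i)}`, then for any `i, j` the total length of the path in `T` from `i` to `j` is
comparable (with constant `C_m` depending only on `m`) to `d(x_i, x_j)`. -/
theorem greedy_spanning_tree_path_length :
    ∀ m : ℕ, 1 ≤ m →
    ∃ C : ℝ, ∀ (M : Type u) [PseudoMetricSpace M] (x : Fin m → M) (p : Fin m → Fin m),
      -- p sends each non-initial vertex to a closest earlier vertex
      (∀ i : Fin m, i.val ≠ 0 →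
        p i < i ∧ ∀ j : Fin m, j < i → dist (x i) (x (p i)) ≤ dist (x i) (x j)) →
      -- the spanning tree T has edge set {{i, p i} : i ≠ 0}
      ∀ (i j : Fin m)
        (walk : (SimpleGraph.fromRel fun a b : Fin m => a.val ≠ 0 ∧ p a = b).Walk i j),
        walk.IsPath →
        dist (x i) (x j) ≤ (walk.darts.map fun dd => dist (x dd.toProd.1) (x dd.toProd.2)).sum ∧
        (walk.darts.map fun dd => dist (x dd.toProd.1) (x dd.toProd.2)).sum ≤
          C * dist (x i) (x j) := by
  intro m _
  refine ⟨2 ^ m, ?_⟩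
  intro M _ x p hp i j w hw
  refine ⟨walk_lower x w, (greedy_aux x p hp _ i j w hw rfl).trans ?_⟩
  have h := hw.length_lt
  rw [Fintype.card_fin] at h
  have h2 : (2:ℝ) ^ w.length ≤ 2 ^ m := pow_le_pow_right₀ (by norm_num) h.le
  exact mul_le_mul_of_nonneg_right (by linarith) dist_nonneg
end

section
/- For every natural number r and every real ε > 0 there exists a constant C_{r,ε}, depending only on r and ε, with the following property. Let G be an abelian group (written additively), let H be a finite subgroup of G, let v_1,…,v_r ∈ G and reals N_1,…,N_r > 0, and let P := {n_1v_1 + ⋯ + n_rv_r : n_i ∈ ℤ, |n_i| ≤ N_i for all i}. If A is a finite subset of the coset progression H + P with |A| ≥ ε·|H + P|, then for every natural number n ≥ 1 the n-fold sumset nA := A + ⋯ + A satisfies |nA| ≤ C_{r,ε}·n^r·|A|. -/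
open scoped Pointwise

universe u

/-- The coset progression `H + P` in an additive abelian group: `H` a subgroup, plus the
generalised arithmetic progression `{n₁v₁ + ⋯ + n_r v_r : nᵢ ∈ ℤ, |nᵢ| ≤ Nᵢ}`. -/
def cosetProg {G : Type u} [AddCommGroup G] (H : AddSubgroup G) {r : ℕ} (v : Fin r → G)
    (N : Fin r → ℝ) : Set G :=
  { g | ∃ h ∈ H, ∃ m : Fin r → ℤ, (∀ i, |(m i : ℝ)| ≤ N i) ∧ g = h + ∑ i, m i • v i }

/-- The `n`-fold iterated sumset `nA = A + ⋯ + A` of a finite subset of an abelian group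
(with `0A = {0}`). -/
def iterSum {G : Type u} [AddCommGroup G] [DecidableEq G] (A : Finset G) : ℕ → Finset G
  | 0 => {0}
  | n + 1 => A + iterSum A n

theorem aux_iter {G : Type u} [AddCommGroup G] [DecidableEq G] (H : AddSubgroup G) {r : ℕ}
    (v : Fin r → G) (N : Fin r → ℝ) (A : Finset G) (hA : ↑A ⊆ cosetProg H v N) (n : ℕ) :
    ∀ x ∈ iterSum A n, ∃ h ∈ H, ∃ m : Fin r → ℤ,
      (∀ i, |m i| ≤ n * ⌊N i⌋) ∧ x = h + ∑ i, m i • v i := by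
  induction n with
  | zero =>
    intro x hx
    simp only [iterSum, Finset.mem_singleton] at hx
    exact ⟨0, H.zero_mem, 0, by simp, by simp [hx]⟩
  | succ n ih =>
    intro x hx
    simp only [iterSum, Finset.mem_add] at hx
    obtain ⟨a, ha, b, hb, rfl⟩ := hx
    obtain ⟨h₁, hh₁, m₁, hm₁, rfl⟩ := hA ha
    obtain ⟨h₂, hh₂, m₂, hm₂, rfl⟩ := ih b hb
    refine ⟨h₁ + h₂, H.add_mem hh₁ hh₂, m₁ + m₂, fun i => ?_, ?_⟩
    · have h1 : |m₁ i| ≤ ⌊N i⌋ := by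
        rw [Int.le_floor]; push_cast; exact hm₁ i
      have h3 := abs_add_le (m₁ i) (m₂ i)
      have h2 := hm₂ i
      simp only [Pi.add_apply]
      push_cast
      linarith
    · simp only [Pi.add_apply, add_smul, Finset.sum_add_distrib]
      abel

theorem aux_div (n : ℕ) (M m : ℤ) (hM : 0 ≤ M) (hm : |m| ≤ n * M) :
    -(n : ℤ) ≤ m / M ∧ m / M ≤ n ∧ |m % M| ≤ M := by
  rw [abs_le] at hm
  rcases hM.eq_or_lt with rfl | hM
  · have : m = 0 := by simp at hm; omega
    simp [this]
  · refine ⟨?_, ?_, ?_⟩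
    · rw [Int.le_ediv_iff_mul_le hM]; linarith
    · have := Int.ediv_le_ediv hM hm.2
      rwa [Int.mul_ediv_cancel _ hM.ne'] at this
    · rw [abs_of_nonneg (Int.emod_nonneg _ hM.ne')]
      exact (Int.emod_lt_of_pos _ hM).le

theorem aux_fin {G : Type u} [AddCommGroup G] (H : AddSubgroup G) {r : ℕ}
    (v : Fin r → G) (N : Fin r → ℝ) (hH : (H : Set G).Finite) : (cosetProg H v N).Finite := by
  have hF : (Set.Icc (fun i => -⌊N i⌋) (fun i => ⌊N i⌋) : Set (Fin r → ℤ)).Finite :=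
    Set.finite_Icc _ _
  refine ((hH.prod hF).image (fun p => p.1 + ∑ i, p.2 i • v i)).subset ?_
  rintro g ⟨h, hh, m, hm, rfl⟩
  have key : ∀ i, |m i| ≤ ⌊N i⌋ := fun i => by
    rw [Int.le_floor]; push_cast; exact hm i
  exact ⟨(h, m), ⟨hh, fun i => (abs_le.1 (key i)).1, fun i => (abs_le.1 (key i)).2⟩, rfl⟩

/-- **Direct theorem accompanying the polynomial growth inverse theorem** (from the
introduction of Tao, "Inverse theorems for sets and measures of polynomial growth"): a dense
subset `A` of a coset progression `H + P` of rank `r` satisfies `|nA| ≤ C_{r,ε} n^r |A|` for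
all `n ≥ 1`. -/
theorem direct_polynomial_growth_theorem :
    ∀ (r : ℕ) (ε : ℝ), 0 < ε →
    ∃ C : ℝ, ∀ (G : Type u) [AddCommGroup G] [DecidableEq G] (H : AddSubgroup G)
      (v : Fin r → G) (N : Fin r → ℝ) (A : Finset G),
      (H : Set G).Finite → (∀ i, 0 < N i) →
      ↑A ⊆ cosetProg H v N →
      ε * (Nat.card (cosetProg H v N) : ℝ) ≤ (A.card : ℝ) →
      ∀ n : ℕ, 1 ≤ n → ((iterSum A n).card : ℝ) ≤ C * (n : ℝ) ^ r * (A.card : ℝ) := by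
  intro r ε hε
  refine ⟨3 ^ r / ε, ?_⟩
  intro G _ _ H v N A hH hN hA hcard n hn
  have hfin := aux_fin H v N hH
  have hsub : iterSum A n ⊆ ((Fintype.piFinset (fun _ : Fin r => Finset.Icc (-(n : ℤ)) n)) ×ˢ
      hfin.toFinset).image (fun p => p.2 + ∑ i, (p.1 i * ⌊N i⌋) • v i) := by
    intro x hx
    obtain ⟨h, hh, m, hm, rfl⟩ := aux_iter H v N A hA n x hx
    have hd := fun i => aux_div n ⌊N i⌋ (m i) (Int.floor_nonneg.2 (hN i).le) (hm i)
    rw [Finset.mem_image]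
    refine ⟨(fun i => m i / ⌊N i⌋, h + ∑ i, (m i % ⌊N i⌋) • v i), ?_, ?_⟩
    · rw [Finset.mem_product, Fintype.mem_piFinset, Set.Finite.mem_toFinset]
      refine ⟨fun i => Finset.mem_Icc.2 ⟨(hd i).1, (hd i).2.1⟩,
        h, hh, fun i => m i % ⌊N i⌋, fun i => ?_, rfl⟩
      have := (hd i).2.2
      rw [Int.le_floor] at this
      push_cast at this
      exact this
    · simp only
      rw [add_assoc, ← Finset.sum_add_distrib]
      congr 1
      refine Finset.sum_congr rfl fun i _ => ?_
      rw [← add_smul, Int.emod_add_ediv_mul]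
  have h1 := (Finset.card_le_card hsub).trans Finset.card_image_le
  rw [Finset.card_product, Fintype.card_piFinset] at h1
  simp only [Int.card_Icc, Finset.prod_const, Finset.card_univ, Fintype.card_fin] at h1
  have h2 : ((n : ℤ) + 1 - -(n : ℤ)).toNat ≤ 3 * n := by omega
  have h3 : hfin.toFinset.card = Nat.card (cosetProg H v N) := by
    rw [Nat.card_coe_set_eq, Set.ncard_eq_toFinset_card _ hfin]
  have h4 : (iterSum A n).card ≤ (3 * n) ^ r * Nat.card (cosetProg H v N) := by
    rw [← h3]
    exact h1.trans (Nat.mul_le_mul_right _ (Nat.pow_le_pow_left h2 r))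
  have h5 : ((iterSum A n).card : ℝ) ≤ (3 * n) ^ r * (Nat.card (cosetProg H v N) : ℝ) := by
    exact_mod_cast h4
  have h6 : (Nat.card (cosetProg H v N) : ℝ) ≤ A.card / ε := by
    rw [le_div_iff₀ hε]; linarith
  calc ((iterSum A n).card : ℝ) ≤ (3 * n) ^ r * (Nat.card (cosetProg H v N) : ℝ) := h5
    _ ≤ (3 * n) ^ r * (A.card / ε) := by gcongr
    _ = 3 ^ r / ε * (n : ℝ) ^ r * (A.card : ℝ) := by rw [mul_pow]; ring
end

section
/- There is an absolute constant C ≥ 1 with the following property. For natural numbers N ≥ 1 and m ≥ 1, let G be the Heisenberg group of 3×3 upper unitriangular integer matrices (matrices [[1,a,b],[0,1,c],[0,0,1]] with a,b,c ∈ ℤ under matrix multiplication), let A ⊆ G be the set of such matrices with |a| ≤ N, |c| ≤ N, and |b| ≤ N³, and let S := A ∪ {1} ∪ A⁻¹ where 1 is the identity matrix and A⁻¹ := {g⁻¹ : g ∈ A}. Then C⁻¹·m²N²·(mN³ + m²N²) ≤ |Sᵐ| ≤ C·m²N²·(mN³ + m²N²). -/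
open scoped Pointwise

namespace HeisAux

abbrev M3 := Matrix (Fin 3) (Fin 3) ℤ

def H (a b c : ℤ) : M3 := !![1, a, b; 0, 1, c; 0, 0, 1]

lemma H_mul (a b c a' b' c' : ℤ) :
    H a b c * H a' b' c' = H (a + a') (b + b' + a * c') (c + c') := by
  ext i j
  fin_cases i <;> fin_cases j <;>
    simp [H, Matrix.mul_apply, Fin.sum_univ_three] <;> ring

lemma H_one : H 0 0 0 = 1 := by
  ext i j
  fin_cases i <;> fin_cases j <;> simp [H]

lemma H_inj {a b c a' b' c' : ℤ} (h : H a b c = H a' b' c') : a = a' ∧ b = b' ∧ c = c' := by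
  have h1 := congrFun (congrFun h 0) 1
  have h2 := congrFun (congrFun h 0) 2
  have h3 := congrFun (congrFun h 1) 2
  simp [H] at h1 h2 h3
  exact ⟨h1, h2, h3⟩

lemma mul_mem' {S : Finset M3} {i j : ℕ} {x y : M3} (hx : x ∈ S ^ i) (hy : y ∈ S ^ j) :
    x * y ∈ S ^ (i + j) := by
  rw [pow_add]; exact Finset.mul_mem_mul hx hy

lemma split_int (L : ℤ) (hL : 0 ≤ L) (k : ℕ) (x : ℤ) (hx : |x| ≤ (k + 1) * L) :
    ∃ y z : ℤ, |y| ≤ k * L ∧ |z| ≤ L ∧ x = y + z := by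
  have hk : 0 ≤ (k : ℤ) * L := by positivity
  rw [abs_le] at hx
  have e : ((k : ℤ) + 1) * L = k * L + L := by ring
  rw [e] at hx
  generalize (k : ℤ) * L = K at *
  refine ⟨max (-K) (min K x), x - max (-K) (min K x), ?_, ?_, by ring⟩
  · rw [abs_le]; omega
  · rw [abs_le]; omega

section low
variable {S : Finset M3} {N : ℕ}
  (hS : ∀ a b c : ℤ, |a| ≤ N → |b| ≤ (N : ℤ) ^ 3 → |c| ≤ N → H a b c ∈ S)
include hS

lemma memA (k : ℕ) : ∀ a : ℤ, |a| ≤ k * (N : ℤ) → H a 0 0 ∈ S ^ k := by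
  induction k with
  | zero => intro a ha; have : a = 0 := by simpa using ha
            subst this; simp [H_one]
  | succ k ih =>
    intro a ha
    obtain ⟨y, z, hy, hz, rfl⟩ := split_int N (by positivity) k a (by push_cast at ha; exact ha)
    have := Finset.mul_mem_mul (ih y hy) (hS z 0 0 hz (by simp) (by simp))
    rw [H_mul, ← pow_succ] at this
    simpa using this

lemma memC (k : ℕ) : ∀ a : ℤ, |a| ≤ k * (N : ℤ) → H 0 0 a ∈ S ^ k := by
  induction k with
  | zero => intro a ha; have : a = 0 := by simpa using ha
            subst this; simp [H_one]
  | succ k ih =>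
    intro a ha
    obtain ⟨y, z, hy, hz, rfl⟩ := split_int N (by positivity) k a (by push_cast at ha; exact ha)
    have := Finset.mul_mem_mul (ih y hy) (hS 0 0 z (by simp) (by simp) hz)
    rw [H_mul, ← pow_succ] at this
    simpa using this

lemma memB (k : ℕ) : ∀ a : ℤ, |a| ≤ k * (N : ℤ) ^ 3 → H 0 a 0 ∈ S ^ k := by
  induction k with
  | zero => intro a ha; have : a = 0 := by simpa using ha
            subst this; simp [H_one]
  | succ k ih =>
    intro a ha
    obtain ⟨y, z, hy, hz, rfl⟩ := split_int ((N : ℤ) ^ 3) (by positivity) k a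
      (by push_cast at ha; exact ha)
    have := Finset.mul_mem_mul (ih y hy) (hS 0 z 0 (by simp) hz (by simp))
    rw [H_mul, ← pow_succ] at this
    simpa using this

lemma memComm (k : ℕ) (a c : ℤ) (ha : |a| ≤ k * (N : ℤ)) (hc : |c| ≤ k * (N : ℤ)) :
    H 0 (a * c) 0 ∈ S ^ (k + k + k + k) := by
  have := mul_mem' (mul_mem' (mul_mem' (memA hS k a ha) (memC hS k c hc))
    (memA hS k (-a) (by simpa using ha))) (memC hS k (-c) (by simpa using hc))
  simpa [H_mul] using this

lemma memSq (k : ℕ) (b : ℤ) (hb : |b| ≤ (k * (N : ℤ)) ^ 2) :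
    H 0 b 0 ∈ S ^ ((k + k + k + k) + (k + k + k + k)) := by
  have key : ∃ q r : ℤ, |q| ≤ k * (N : ℤ) ∧ |r| ≤ k * (N : ℤ) ∧ b = (k * (N : ℤ)) * q + r * 1 ∧
      (1 ≤ k * (N : ℤ) ∨ r = 0) := by
    have h0 : 0 ≤ (k : ℤ) * N := by positivity
    generalize (k : ℤ) * N = L at *
    rcases h0.eq_or_lt with h | h
    · subst h
      refine ⟨0, 0, by simp, by simp, ?_, Or.inr rfl⟩
      simpa using hb
    · rw [abs_le] at hb
      have h1 := Int.emod_nonneg b h.ne'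
      have h2 := Int.emod_lt_of_pos b h
      have h3 := Int.mul_ediv_add_emod b L
      refine ⟨b / L, b % L, ?_, ?_, by linarith, Or.inl h⟩
      · rw [abs_le]
        constructor
        · rw [Int.le_ediv_iff_mul_le h]; nlinarith
        · apply Int.ediv_le_of_le_mul h; nlinarith
      · rw [abs_le]; constructor <;> linarith
  obtain ⟨q, r, hq, hr, rfl, h⟩ := key
  have hL : |(k : ℤ) * N| ≤ k * (N : ℤ) := by rw [abs_of_nonneg (by positivity)]
  have h1 := memComm hS k _ _ hL hq
  have h2 : H 0 (r * 1) 0 ∈ S ^ (k + k + k + k) := by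
    rcases h with h | h
    · exact memComm hS k _ _ hr (by simpa using h)
    · have := memComm hS k 0 0 (by simp; positivity) (by simp; positivity)
      subst h; simpa using this
  have := mul_mem' h1 h2
  simpa [H_mul] using this

lemma memAll (k : ℕ) (a b c : ℤ) (ha : |a| ≤ k * (N : ℤ)) (hc : |c| ≤ k * (N : ℤ))
    (hb : |b| ≤ k * (N : ℤ) ^ 3 + (k * (N : ℤ)) ^ 2) :
    H a (a * c + b) c ∈ S ^ (11 * k) := by
  obtain ⟨y, z, hy, hz, rfl⟩ : ∃ y z : ℤ, |y| ≤ k * (N : ℤ) ^ 3 ∧ |z| ≤ (k * (N : ℤ)) ^ 2 ∧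
      b = y + z := by
    have h1 : 0 ≤ (k : ℤ) * N ^ 3 := by positivity
    have h2 : 0 ≤ ((k : ℤ) * N) ^ 2 := by positivity
    generalize (k : ℤ) * N ^ 3 = K at *
    generalize ((k : ℤ) * N) ^ 2 = L at *
    rw [abs_le] at hb
    refine ⟨max (-K) (min K b), b - max (-K) (min K b), ?_, ?_, by ring⟩
    · rw [abs_le]; omega
    · rw [abs_le]; omega
  have := mul_mem' (mul_mem' (mul_mem' (memA hS k a ha) (memC hS k c hc))
    (memB hS k y hy)) (memSq hS k z hz)
  rw [show 11 * k = k + k + k + ((k + k + k + k) + (k + k + k + k)) by ring]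
  convert this using 1
  simp only [H_mul]
  congr 1 <;> ring

lemma lowCard (k : ℕ) :
    (2 * (k * N) + 1) ^ 2 * (2 * (k * N ^ 3 + (k * N) ^ 2) + 1) ≤ (S ^ (11 * k)).card := by
  let L : ℤ := k * (N : ℤ)
  let K : ℤ := k * (N : ℤ) ^ 3 + (k * (N : ℤ)) ^ 2
  have := Finset.card_le_card_of_injOn (s := Finset.Icc (-L) L ×ˢ Finset.Icc (-K) K ×ˢ
    Finset.Icc (-L) L) (t := S ^ (11 * k)) (fun p => H p.1 (p.1 * p.2.2 + p.2.1) p.2.2)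
    (by
      rintro ⟨a, b, c⟩ h
      simp only [Finset.coe_product, Finset.coe_Icc, Set.mem_prod, Set.mem_Icc] at h
      exact memAll hS k a b c (abs_le.2 h.1) (abs_le.2 h.2.2) (abs_le.2 h.2.1))
    (by
      rintro ⟨a, b, c⟩ - ⟨a', b', c'⟩ - h
      obtain ⟨h1, h2, h3⟩ := H_inj h
      dsimp only at h1 h2 h3
      subst h1 h3
      simpa using h2)
  refine le_trans (le_of_eq ?_) this
  simp only [Finset.card_product, Int.card_Icc]
  have e1 : (L + 1 - -L).toNat = 2 * (k * N) + 1 := by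
    have : L + 1 - -L = ((2 * (k * N) + 1 : ℕ) : ℤ) := by simp only [L]; push_cast; ring
    rw [this, Int.toNat_natCast]
  have e2 : (K + 1 - -K).toNat = 2 * (k * N ^ 3 + (k * N) ^ 2) + 1 := by
    have : K + 1 - -K = ((2 * (k * N ^ 3 + (k * N) ^ 2) + 1 : ℕ) : ℤ) := by
      simp only [K]; push_cast; ring
    rw [this, Int.toNat_natCast]
  rw [e1, e2]; ring

lemma lowCard1 : (2 * N + 1) ^ 2 * (2 * N ^ 3 + 1) ≤ S.card := by
  let L : ℤ := (N : ℤ)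
  let K : ℤ := (N : ℤ) ^ 3
  have := Finset.card_le_card_of_injOn (s := Finset.Icc (-L) L ×ˢ Finset.Icc (-K) K ×ˢ
    Finset.Icc (-L) L) (t := S) (fun p => H p.1 p.2.1 p.2.2)
    (by
      rintro ⟨a, b, c⟩ h
      simp only [Finset.coe_product, Finset.coe_Icc, Set.mem_prod, Set.mem_Icc] at h
      exact hS a b c (abs_le.2 h.1) (abs_le.2 h.2.1) (abs_le.2 h.2.2))
    (by
      rintro ⟨a, b, c⟩ - ⟨a', b', c'⟩ - h
      obtain ⟨h1, h2, h3⟩ := H_inj h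
      dsimp only at h1 h2 h3
      subst h1 h2 h3
      rfl)
  refine le_trans (le_of_eq ?_) this
  simp only [Finset.card_product, Int.card_Icc]
  have e1 : (L + 1 - -L).toNat = 2 * N + 1 := by
    have : L + 1 - -L = ((2 * N + 1 : ℕ) : ℤ) := by simp only [L]; push_cast; ring
    rw [this, Int.toNat_natCast]
  have e2 : (K + 1 - -K).toNat = 2 * N ^ 3 + 1 := by
    have : K + 1 - -K = ((2 * N ^ 3 + 1 : ℕ) : ℤ) := by
      simp only [K]; push_cast; ring
    rw [this, Int.toNat_natCast]
  rw [e1, e2]; ring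

lemma lower (hN : 1 ≤ N) (m : ℕ) (hm : 1 ≤ m) :
    m ^ 2 * N ^ 2 * (m * N ^ 3 + m ^ 2 * N ^ 2) ≤ 234256 * (S ^ m).card := by
  have h1S : (1 : M3) ∈ S := by
    rw [← H_one]; exact hS 0 0 0 (by simp) (by simp) (by simp)
  rcases lt_or_ge m 11 with h | h
  · have h1 := lowCard1 hS
    have h2 : S.card ≤ (S ^ m).card := by
      have := Finset.card_le_card (Finset.pow_subset_pow_right h1S hm)
      simpa using this
    have h3 : N ^ 2 * N ^ 3 ≤ (2 * N + 1) ^ 2 * (2 * N ^ 3 + 1) := by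
      gcongr <;> omega
    have h4 : N ^ 2 ≤ N ^ 3 := Nat.pow_le_pow_right hN (by norm_num)
    calc m ^ 2 * N ^ 2 * (m * N ^ 3 + m ^ 2 * N ^ 2)
        ≤ 11 ^ 2 * N ^ 2 * (11 * N ^ 3 + 11 ^ 2 * N ^ 3) := by gcongr
      _ = 15972 * (N ^ 2 * N ^ 3) := by ring
      _ ≤ 234256 * (S ^ m).card := by omega
  · obtain ⟨k, hk1, hk2⟩ : ∃ k, 11 * k ≤ m ∧ m ≤ 22 * k := ⟨m / 11, by omega, by omega⟩
    have h1 := lowCard hS k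
    have h2 := Finset.card_le_card (Finset.pow_subset_pow_right h1S hk1)
    have h3 : (k * N) ^ 2 * (k * N ^ 3 + (k * N) ^ 2) ≤
      (2 * (k * N) + 1) ^ 2 * (2 * (k * N ^ 3 + (k * N) ^ 2) + 1) := by
      exact Nat.mul_le_mul (Nat.pow_le_pow_left (by omega) 2) (by omega)
    calc m ^ 2 * N ^ 2 * (m * N ^ 3 + m ^ 2 * N ^ 2)
        ≤ (22 * k) ^ 2 * N ^ 2 * ((22 * k) * N ^ 3 + (22 * k) ^ 2 * N ^ 2) := by gcongr
      _ ≤ (22 * k) ^ 2 * N ^ 2 * ((22 ^ 2 * k) * N ^ 3 + (22 * k) ^ 2 * N ^ 2) := by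
        gcongr; norm_num
      _ = 234256 * ((k * N) ^ 2 * (k * N ^ 3 + (k * N) ^ 2)) := by ring
      _ ≤ 234256 * (S ^ m).card := by omega

end low

lemma upMem {S : Finset M3} {N : ℕ}
    (hS : ∀ x ∈ S, ∃ a b c : ℤ, x = H a b c ∧ |a| ≤ N ∧ |b| ≤ 2 * (N : ℤ) ^ 3 ∧ |c| ≤ N)
    (m : ℕ) : ∀ x ∈ S ^ m, ∃ a b c : ℤ, x = H a b c ∧ |a| ≤ m * (N : ℤ) ∧
      |b| ≤ 2 * m * (N : ℤ) ^ 3 + m ^ 2 * (N : ℤ) ^ 2 ∧ |c| ≤ m * (N : ℤ) := by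
  induction m with
  | zero =>
    intro x hx
    refine ⟨0, 0, 0, ?_, by simp, by simp, by simp⟩
    rw [H_one]; simpa using hx
  | succ m ih =>
    intro x hx
    rw [pow_succ] at hx
    obtain ⟨y, hy, z, hz, rfl⟩ := Finset.mem_mul.1 hx
    obtain ⟨a, b, c, rfl, ha, hb, hc⟩ := ih y hy
    obtain ⟨a', b', c', rfl, ha', hb', hc'⟩ := hS z hz
    refine ⟨_, _, _, H_mul _ _ _ _ _ _, ?_, ?_, ?_⟩
    · push_cast; linarith [abs_add_le a a']
    · have h1 : |a * c'| ≤ (m * (N : ℤ)) * N := by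
        rw [abs_mul]; gcongr
      have h2 := abs_add_le (b + b') (a * c')
      have h3 := abs_add_le b b'
      have h4 : 0 ≤ (m : ℤ) * N ^ 2 := by positivity
      have h5 : 0 ≤ (N : ℤ) ^ 2 := by positivity
      push_cast; nlinarith
    · push_cast; linarith [abs_add_le c c']

lemma upper {S : Finset M3} {N : ℕ} (hN : 1 ≤ N)
    (hS : ∀ x ∈ S, ∃ a b c : ℤ, x = H a b c ∧ |a| ≤ N ∧ |b| ≤ 2 * (N : ℤ) ^ 3 ∧ |c| ≤ N)
    (m : ℕ) (hm : 1 ≤ m) :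
    (S ^ m).card ≤ 234256 * (m ^ 2 * N ^ 2 * (m * N ^ 3 + m ^ 2 * N ^ 2)) := by
  let L : ℤ := m * (N : ℤ)
  let K : ℤ := 2 * m * (N : ℤ) ^ 3 + m ^ 2 * (N : ℤ) ^ 2
  have hsub : S ^ m ⊆ (Finset.Icc (-L) L ×ˢ Finset.Icc (-K) K ×ˢ
    Finset.Icc (-L) L).image (fun p => H p.1 p.2.1 p.2.2) := by
    intro x hx
    obtain ⟨a, b, c, rfl, ha, hb, hc⟩ := upMem hS m x hx
    refine Finset.mem_image.2 ⟨(a, b, c), ?_, rfl⟩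
    simp only [Finset.mem_product, Finset.mem_Icc]
    exact ⟨abs_le.1 ha, abs_le.1 hb, abs_le.1 hc⟩
  have := (Finset.card_le_card hsub).trans Finset.card_image_le
  refine this.trans ?_
  simp only [Finset.card_product, Int.card_Icc]
  have e1 : (L + 1 - -L).toNat = 2 * (m * N) + 1 := by
    have : L + 1 - -L = ((2 * (m * N) + 1 : ℕ) : ℤ) := by simp only [L]; push_cast; ring
    rw [this, Int.toNat_natCast]
  have e2 : (K + 1 - -K).toNat = 2 * (2 * m * N ^ 3 + m ^ 2 * N ^ 2) + 1 := by
    have : K + 1 - -K = ((2 * (2 * m * N ^ 3 + m ^ 2 * N ^ 2) + 1 : ℕ) : ℤ) := by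
      simp only [K]; push_cast; ring
    rw [this, Int.toNat_natCast]
  rw [e1, e2]
  have p1 : 1 ≤ m * N := Nat.mul_pos hm hN
  have p2 : 1 ≤ m ^ 2 * N ^ 2 := by
    have : 0 < m ^ 2 * N ^ 2 := by positivity
    exact this
  calc (2 * (m * N) + 1) * ((2 * (2 * m * N ^ 3 + m ^ 2 * N ^ 2) + 1) * (2 * (m * N) + 1))
      ≤ (3 * (m * N)) * ((4 * (m * N ^ 3 + m ^ 2 * N ^ 2)) * (3 * (m * N))) := by
        gcongr
        · omega
        · nlinarith
        · omega
    _ = 36 * (m ^ 2 * N ^ 2 * (m * N ^ 3 + m ^ 2 * N ^ 2)) := by ring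
    _ ≤ _ := by gcongr; norm_num

end HeisAux

/-- **Example 1.13** of Tao, "Inverse theorems for sets and measures of polynomial growth":
in the integer Heisenberg group of 3×3 upper unitriangular matrices, with `A` the set of such
matrices with `|a|,|c| ≤ N` and `|b| ≤ N³`, and `S = A ∪ {1} ∪ A⁻¹`, one has
`|Sᵐ| ≍ m²N²(mN³ + m²N²)` with absolute implied constants. -/
theorem heisenberg_box_growth :
    ∃ C : ℝ, 1 ≤ C ∧
    ∀ N m : ℕ, 1 ≤ N → 1 ≤ m →
      ∀ S : Finset (Matrix (Fin 3) (Fin 3) ℤ),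
      S = ((((Finset.Icc (-(N : ℤ)) (N : ℤ)) ×ˢ
              (Finset.Icc (-((N : ℤ) ^ 3)) ((N : ℤ) ^ 3)) ×ˢ
              (Finset.Icc (-(N : ℤ)) (N : ℤ))).image
            fun p : ℤ × ℤ × ℤ => !![1, p.1, p.2.1; 0, 1, p.2.2; 0, 0, 1]) ∪
          {(1 : Matrix (Fin 3) (Fin 3) ℤ)} ∪
          (((Finset.Icc (-(N : ℤ)) (N : ℤ)) ×ˢ
              (Finset.Icc (-((N : ℤ) ^ 3)) ((N : ℤ) ^ 3)) ×ˢ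
              (Finset.Icc (-(N : ℤ)) (N : ℤ))).image
            fun p : ℤ × ℤ × ℤ =>
              !![1, -p.1, p.1 * p.2.2 - p.2.1; 0, 1, -p.2.2; 0, 0, 1])) →
      C⁻¹ * ((m : ℝ) ^ 2 * (N : ℝ) ^ 2 * ((m : ℝ) * (N : ℝ) ^ 3 + (m : ℝ) ^ 2 * (N : ℝ) ^ 2))
          ≤ ((S ^ m).card : ℝ) ∧
        ((S ^ m).card : ℝ) ≤
          C * ((m : ℝ) ^ 2 * (N : ℝ) ^ 2 *
            ((m : ℝ) * (N : ℝ) ^ 3 + (m : ℝ) ^ 2 * (N : ℝ) ^ 2)) := by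
  refine ⟨234256, by norm_num, ?_⟩
  intro N m hN hm S hSdef
  have hlow : ∀ a b c : ℤ, |a| ≤ N → |b| ≤ (N : ℤ) ^ 3 → |c| ≤ N → HeisAux.H a b c ∈ S := by
    intro a b c ha hb hc
    rw [hSdef]
    refine Finset.mem_union_left _ (Finset.mem_union_left _ (Finset.mem_image.2 ⟨(a, b, c), ?_, rfl⟩))
    simp only [Finset.mem_product, Finset.mem_Icc]
    exact ⟨abs_le.1 ha, abs_le.1 hb, abs_le.1 hc⟩
  have hN2 : (N : ℤ) * N ≤ (N : ℤ) ^ 3 := by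
    have : (1 : ℤ) ≤ N := by exact_mod_cast hN
    nlinarith [mul_self_nonneg (N : ℤ)]
  have hup : ∀ x ∈ S, ∃ a b c : ℤ, x = HeisAux.H a b c ∧ |a| ≤ N ∧ |b| ≤ 2 * (N : ℤ) ^ 3 ∧
      |c| ≤ N := by
    intro x hx
    rw [hSdef, Finset.mem_union, Finset.mem_union] at hx
    rcases hx with (hx | hx) | hx
    · obtain ⟨⟨a, b, c⟩, h, rfl⟩ := Finset.mem_image.1 hx
      simp only [Finset.mem_product, Finset.mem_Icc] at h
      refine ⟨a, b, c, rfl, abs_le.2 h.1, ?_, abs_le.2 h.2.2⟩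
      have := abs_le.2 h.2.1
      have h0 : 0 ≤ (N : ℤ) ^ 3 := by positivity
      linarith
    · rw [Finset.mem_singleton] at hx
      exact ⟨0, 0, 0, by rw [hx, HeisAux.H_one], by simp, by simp, by simp⟩
    · obtain ⟨⟨a, b, c⟩, h, rfl⟩ := Finset.mem_image.1 hx
      simp only [Finset.mem_product, Finset.mem_Icc] at h
      have h1 := abs_le.2 h.1
      have h2 := abs_le.2 h.2.1
      have h3 := abs_le.2 h.2.2
      refine ⟨-a, a * c - b, -c, rfl, by simpa using h1, ?_, by simpa using h3⟩
      have h4 := abs_sub (a * c) b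
      have h5 : |a * c| ≤ (N : ℤ) * N := by rw [abs_mul]; gcongr
      linarith
  have hl := HeisAux.lower hlow hN m hm
  have hu := HeisAux.upper hN hup m hm
  constructor
  · rw [inv_mul_le_iff₀ (by norm_num)]
    exact_mod_cast hl
  · exact_mod_cast hu
end
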